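/- arXiv:2306.12613 — 5 statements merged into one kernel-verified Lean document; each statement's English description precedes it below -/
import Mathlib

section
/- Two pairs of k×k projection matrices p = (p₁, p₂) and q = (q₁, q₂) are unitarily equivalent if and only if their characteristic polynomials coincide, i.e., det(z₀I + z₁p₁ + z₂p₂) = det(z₀I + z₁q₁ + z₂q₂) for all (z₀, z₁, z₂) ∈ ℂ³. -/
namespace ProjPair

open Matrix
open scoped ComplexOrder

variable {n : Type*} [Fintype n] [DecidableEq n]

lemma spec (A : Matrix n n ℂ) (hA : A.IsHermitian) :
    ∃ V : Matrix n n ℂ, Vᴴ * V = 1 ∧ V * Vᴴ = 1 ∧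
      A = V * diagonal (fun i => (hA.eigenvalues i : ℂ)) * Vᴴ := by
  refine ⟨hA.eigenvectorUnitary, ?_, ?_, ?_⟩
  · exact Unitary.coe_star_mul_self hA.eigenvectorUnitary
  · exact Unitary.coe_mul_star_self hA.eigenvectorUnitary
  · exact hA.spectral_theorem

lemma equiv_of_charpoly (A A' : Matrix n n ℂ) (hA : A.IsHermitian) (hA' : A'.IsHermitian)
    (h : A.charpoly = A'.charpoly) :
    ∃ (a : n → ℝ) (V V' : Matrix n n ℂ), Vᴴ * V = 1 ∧ V * Vᴴ = 1 ∧ V'ᴴ * V' = 1 ∧ V' * V'ᴴ = 1 ∧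
      A = V * diagonal (fun i => (a i : ℂ)) * Vᴴ ∧
      A' = V' * diagonal (fun i => (a i : ℂ)) * V'ᴴ := by
  obtain ⟨V, h1, h2, h3⟩ := spec A hA
  obtain ⟨V', h1', h2', h3'⟩ := spec A' hA'
  rw [← (hA.eigenvalues_eq_eigenvalues_iff hA').2 h] at h3'
  exact ⟨_, V, V', h1, h2, h1', h2', h3, h3'⟩

lemma sum_aux (f : n → ℝ) (hf : ∀ i, f i * f i * f i = f i) :
    (∏ i, (Polynomial.X - Polynomial.C (f i : ℂ))) =
      (Polynomial.X - Polynomial.C 1) ^ (Finset.univ.filter (fun i => f i = 1)).card *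
      ((Polynomial.X - Polynomial.C (-1)) ^ (Finset.univ.filter (fun i => f i = -1)).card *
      Polynomial.X ^ (Finset.univ.filter (fun i => f i = 0)).card) := by
  rw [← Finset.prod_const, ← Finset.prod_const, ← Finset.prod_const, Finset.prod_filter,
    Finset.prod_filter, Finset.prod_filter, ← Finset.prod_mul_distrib, ← Finset.prod_mul_distrib]
  refine Finset.prod_congr rfl fun i _ => ?_
  have : f i = 0 ∨ f i = 1 ∨ f i = -1 := by
    have h : f i * ((f i - 1) * (f i + 1)) = 0 := by linear_combination hf i
    rcases mul_eq_zero.1 h with h | h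
    · exact Or.inl h
    · rcases mul_eq_zero.1 h with h | h
      · right; left; linarith
      · right; right; linarith
  rcases this with h | h | h <;> rw [h] <;> norm_num

lemma card_aux (f : n → ℝ) (hf : ∀ i, f i * f i * f i = f i) :
    2 * ((Finset.univ.filter (fun i => f i = 1)).card : ℝ) = ∑ i, f i * f i + ∑ i, f i ∧
    2 * ((Finset.univ.filter (fun i => f i = -1)).card : ℝ) = ∑ i, f i * f i - ∑ i, f i ∧
    ((Finset.univ.filter (fun i => f i = 0)).card : ℝ) = Fintype.card n - ∑ i, f i * f i := by
  have key : ∀ i, f i = 0 ∨ f i = 1 ∨ f i = -1 := by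
    intro i
    have h : f i * ((f i - 1) * (f i + 1)) = 0 := by linear_combination hf i
    rcases mul_eq_zero.1 h with h | h
    · exact Or.inl h
    · rcases mul_eq_zero.1 h with h | h
      · right; left; linarith
      · right; right; linarith
  have hc : (Fintype.card n : ℝ) = ∑ i : n, 1 := by simp
  rw [hc]
  simp only [Finset.card_filter, Nat.cast_sum, Finset.mul_sum, ← Finset.sum_add_distrib,
    ← Finset.sum_sub_distrib]
  refine ⟨?_, ?_, ?_⟩ <;> refine Finset.sum_congr rfl fun i _ => ?_ <;>
    rcases key i with h | h | h <;> rw [h] <;> norm_num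

lemma diag_conj_inj {V : Matrix n n ℂ} (h1 : Vᴴ * V = 1) {X Y : Matrix n n ℂ}
    (h : V * X * Vᴴ = V * Y * Vᴴ) : X = Y := by
  have := congrArg (fun Z => Vᴴ * Z * V) h
  simpa only [Matrix.mul_assoc, h1, Matrix.mul_one, ← Matrix.mul_assoc Vᴴ V, Matrix.one_mul]
    using this

lemma eig_facts (M : Matrix n n ℂ) (hM : M.IsHermitian) (h3 : M * M * M = M) :
    (∀ i, hM.eigenvalues i * hM.eigenvalues i * hM.eigenvalues i = hM.eigenvalues i) ∧
    ((∑ i, hM.eigenvalues i : ℝ) : ℂ) = M.trace ∧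
    ((∑ i, hM.eigenvalues i * hM.eigenvalues i : ℝ) : ℂ) = (M * M).trace := by
  obtain ⟨V, h1, h2, h⟩ := spec M hM
  set D : Matrix n n ℂ := diagonal (fun i => (hM.eigenvalues i : ℂ)) with hD
  have hMM : M * M = V * (D * D) * Vᴴ := by
    rw [h]
    calc V * D * Vᴴ * (V * D * Vᴴ) = V * D * (Vᴴ * V) * D * Vᴴ := by
          simp only [Matrix.mul_assoc]
      _ = _ := by rw [h1]; simp only [Matrix.mul_assoc, Matrix.one_mul]
  have hMMM : M * M * M = V * (D * D * D) * Vᴴ := by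
    rw [hMM, h]
    calc V * (D * D) * Vᴴ * (V * D * Vᴴ) = V * (D * D) * (Vᴴ * V) * D * Vᴴ := by
          simp only [Matrix.mul_assoc]
      _ = _ := by rw [h1]; simp only [Matrix.mul_assoc, Matrix.one_mul]
  refine ⟨?_, ?_, ?_⟩
  · intro i
    have := diag_conj_inj h1 (hMMM.symm.trans (h3.trans h))
    have := congrFun (congrFun this i) i
    simp [hD] at this
    exact_mod_cast this
  · rw [hM.trace_eq_sum_eigenvalues]; push_cast; rfl
  · rw [hMM, Matrix.trace_mul_comm, ← Matrix.mul_assoc, h1, Matrix.one_mul, hD]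
    simp [Matrix.trace]

lemma equiv_of_cube (M M' : Matrix n n ℂ) (hM : M.IsHermitian) (hM' : M'.IsHermitian)
    (h3 : M * M * M = M) (h3' : M' * M' * M' = M') (ht : M.trace = M'.trace)
    (ht2 : (M * M).trace = (M' * M').trace) :
    ∃ W : Matrix n n ℂ, Wᴴ * W = 1 ∧ W * Wᴴ = 1 ∧ W * M = M' * W := by
  have hc : M.charpoly = M'.charpoly := by
    obtain ⟨e1, e2, e3⟩ := eig_facts M hM h3
    obtain ⟨e1', e2', e3'⟩ := eig_facts M' hM' h3'
    rw [ht, ← e2'] at e2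
    rw [ht2, ← e3'] at e3
    have e2 := Complex.ofReal_injective e2
    have e3 := Complex.ofReal_injective e3
    obtain ⟨c1, c2, c3⟩ := card_aux _ e1
    obtain ⟨c1', c2', c3'⟩ := card_aux _ e1'
    rw [hM.charpoly_eq, hM'.charpoly_eq]
    refine (sum_aux _ e1).trans (Eq.trans ?_ (sum_aux _ e1').symm)
    have d1 : ((Finset.univ.filter (fun i => hM.eigenvalues i = 1)).card : ℝ) =
        (Finset.univ.filter (fun i => hM'.eigenvalues i = 1)).card := by linarith
    have d2 : ((Finset.univ.filter (fun i => hM.eigenvalues i = -1)).card : ℝ) =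
        (Finset.univ.filter (fun i => hM'.eigenvalues i = -1)).card := by linarith
    have d3 : ((Finset.univ.filter (fun i => hM.eigenvalues i = 0)).card : ℝ) =
        (Finset.univ.filter (fun i => hM'.eigenvalues i = 0)).card := by linarith
    rw [Nat.cast_inj.1 d1, Nat.cast_inj.1 d2, Nat.cast_inj.1 d3]
  obtain ⟨a, V, V', h1, h2, h1', h2', h, h'⟩ := equiv_of_charpoly M M' hM hM' hc
  refine ⟨V' * Vᴴ, ?_, ?_, ?_⟩
  · rw [conjTranspose_mul, conjTranspose_conjTranspose]
    calc V * V'ᴴ * (V' * Vᴴ) = V * (V'ᴴ * V') * Vᴴ := by simp only [Matrix.mul_assoc]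
      _ = 1 := by rw [h1', Matrix.mul_one, h2]
  · rw [conjTranspose_mul, conjTranspose_conjTranspose]
    calc V' * Vᴴ * (V * V'ᴴ) = V' * (Vᴴ * V) * V'ᴴ := by simp only [Matrix.mul_assoc]
      _ = 1 := by rw [h1, Matrix.mul_one, h2']
  · rw [h, h']
    generalize diagonal (fun i => (a i : ℂ)) = D
    calc V' * Vᴴ * (V * D * Vᴴ) = V' * (Vᴴ * V) * D * Vᴴ := by simp only [Matrix.mul_assoc]
      _ = V' * D * (V'ᴴ * V') * Vᴴ := by rw [h1, h1']; simp only [Matrix.mul_one]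
      _ = _ := by simp only [Matrix.mul_assoc]

/-- functional calculus of the diagonal matrix -/
noncomputable def F (a : n → ℝ) (f : ℝ → ℝ) : Matrix n n ℂ := diagonal (fun i => (f (a i) : ℂ))

lemma F_mul (a : n → ℝ) (f g : ℝ → ℝ) : F a f * F a g = F a (fun x => f x * g x) := by
  simp [F]

lemma F_mul' (a : n → ℝ) (f g : ℝ → ℝ) (X : Matrix n n ℂ) :
    F a f * (F a g * X) = F a (fun x => f x * g x) * X := by
  rw [← Matrix.mul_assoc, F_mul]

lemma F_star (a : n → ℝ) (f : ℝ → ℝ) : (F a f)ᴴ = F a f := by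
  simp only [F, diagonal_conjTranspose]
  congr 1; ext i; simp

lemma F_zero (a : n → ℝ) (f : ℝ → ℝ) (h : ∀ x, f x = 0) : F a f = 0 := by
  simp [F, h]

lemma F_anti (a : n → ℝ) (B : Matrix n n ℂ) (h : F a (fun x => x) * B = - (B * F a (fun x => x)))
    (f : ℝ → ℝ) : B * F a f = F a (fun x => f (-x)) * B := by
  ext i j
  have hij := congrFun (congrFun h i) j
  simp only [F, diagonal_mul, mul_diagonal, Matrix.neg_apply] at hij ⊢
  have : ((a i + a j : ℝ) : ℂ) * B i j = 0 := by push_cast; linear_combination hij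
  rcases mul_eq_zero.1 this with h0 | h0
  · have h0 : a i + a j = 0 := by exact_mod_cast h0
    rw [show a j = - a i by linarith, mul_comm]
  · simp [h0]

lemma core (a : n → ℝ) (B B' : Matrix n n ℂ) (hB : B.IsHermitian) (hB' : B'.IsHermitian)
    (ha : F a (fun x => x) * B = - (B * F a (fun x => x)))
    (ha' : F a (fun x => x) * B' = - (B' * F a (fun x => x)))
    (hs : B * B = F a (fun x => 1 - x * x)) (hs' : B' * B' = F a (fun x => 1 - x * x))
    (ht : B.trace = B'.trace) :
    ∃ U : Matrix n n ℂ, U * Uᴴ = 1 ∧ U * F a (fun x => x) = F a (fun x => x) * U ∧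
      U * B = B' * U := by
  have cB := F_anti a B ha
  have cB' := F_anti a B' ha'
  -- the range of `a`
  have hrange : ∀ i, 0 ≤ 1 - a i * a i := by
    intro i
    have h1 := congrFun (congrFun hs i) i
    have h2 : (B * B) i i = ((∑ j, Complex.normSq (B i j) : ℝ) : ℂ) := by
      rw [Matrix.mul_apply]; push_cast
      refine Finset.sum_congr rfl fun j _ => ?_
      rw [← hB.apply j i, Complex.star_def, Complex.mul_conj]
    rw [h2] at h1
    simp only [F, diagonal_apply_eq] at h1
    have h1 := Complex.ofReal_injective h1
    rw [← h1]
    exact Finset.sum_nonneg fun j _ => Complex.normSq_nonneg _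
  have Fcongr : ∀ f g : ℝ → ℝ, (∀ x, -1 ≤ x → x ≤ 1 → f x = g x) → F a f = F a g := by
    intro f g h
    simp only [F]; congr 1; ext i
    rw [h _ (by nlinarith [hrange i]) (by nlinarith [hrange i])]
  -- boundary part vanishes
  have bdry : ∀ C : Matrix n n ℂ, C.IsHermitian → C * C = F a (fun x => 1 - x * x) →
      ∀ f : ℝ → ℝ, (∀ x, -1 ≤ x → x ≤ 1 → f x * (1 - x * x) = 0) → F a f * C = 0 := by
    intro C hC hCC f hf
    rw [← Matrix.self_mul_conjTranspose_eq_zero, conjTranspose_mul, F_star, hC.eq,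
      Matrix.mul_assoc, ← Matrix.mul_assoc C C, hCC, F_mul, F_mul]
    rw [Fcongr _ (fun _ => 0), F_zero _ _ (fun _ => rfl)]
    intro x h1 h2
    linear_combination f x * hf x h1 h2
  let e : ℝ → ℝ := fun x => if x = 0 then 1 else 0
  let r : ℝ → ℝ := fun x => if 0 < x ∨ x ≤ -1 then 1 else 0
  let g : ℝ → ℝ := fun x => if -1 < x ∧ x < 0 then 1 / (1 - x * x) else 0
  have e_neg : (fun x => e (-x)) = e := by ext x; simp [e]
  have eB : B * F a e = F a e * B := by rw [cB, e_neg]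
  have eB' : B' * F a e = F a e * B' := by rw [cB', e_neg]
  have ee : F a e * F a e = F a e := by rw [F_mul]; congr 1; ext x; simp [e]
  have sq : ∀ C : Matrix n n ℂ, C * F a e = F a e * C → C * C = F a (fun x => 1 - x * x) →
      F a e * C * (F a e * C) = F a e := by
    intro C h1 h2
    calc F a e * C * (F a e * C) = F a e * (C * F a e) * C := by simp only [Matrix.mul_assoc]
      _ = F a e * F a e * (C * C) := by rw [h1]; simp only [Matrix.mul_assoc]
      _ = F a e := by
        rw [ee, h2, F_mul]; congr 1; ext x
        by_cases hx : x = 0 <;> simp [e, hx]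
  have tr : ∀ C : Matrix n n ℂ, F a (fun x => x) * C = - (C * F a (fun x => x)) →
      (F a e * C).trace = C.trace := by
    intro C hC
    simp only [Matrix.trace]
    refine Finset.sum_congr rfl fun i _ => ?_
    have hij := congrFun (congrFun hC i) i
    simp only [F, diagonal_mul, mul_diagonal, Matrix.neg_apply, diag_apply] at hij ⊢
    by_cases hx : a i = 0
    · simp [e, hx]
    · have : (2 * (a i : ℂ)) * C i i = 0 := by linear_combination hij
      have hx' : (a i : ℂ) ≠ 0 := by exact_mod_cast hx
      have : C i i = 0 := by
        rcases mul_eq_zero.1 this with h | h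
        · simp [hx'] at h
        · exact h
      simp [this]
  have herm : ∀ C : Matrix n n ℂ, C.IsHermitian → C * F a e = F a e * C →
      (F a e * C).IsHermitian := by
    intro C h1 h2
    rw [Matrix.IsHermitian, conjTranspose_mul, F_star, h1.eq, h2]
  obtain ⟨W, w1, w2, w3⟩ := equiv_of_cube (F a e * B) (F a e * B') (herm B hB eB) (herm B' hB' eB')
    (by rw [sq B eB hs, ← Matrix.mul_assoc, ee]) (by rw [sq B' eB' hs', ← Matrix.mul_assoc, ee])
    (by rw [tr B ha, tr B' ha', ht]) (by rw [sq B eB hs, sq B' eB' hs'])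
  have we : W * F a e = F a e * W := by
    rw [← sq B eB hs, ← Matrix.mul_assoc, w3, Matrix.mul_assoc, w3, ← Matrix.mul_assoc,
      sq B' eB' hs', sq B eB hs]
  -- commutation of B' B with diagonals
  have cBB : ∀ f, B' * B * F a f = F a f * (B' * B) := by
    intro f
    rw [Matrix.mul_assoc, cB, ← Matrix.mul_assoc, cB', Matrix.mul_assoc]
    simp only [neg_neg]
  have cBB' : ∀ f, B * B' * F a f = F a f * (B * B') := by
    intro f
    rw [Matrix.mul_assoc, cB', ← Matrix.mul_assoc, cB, Matrix.mul_assoc]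
    simp only [neg_neg]
  have re : F a r * F a e = 0 := by
    rw [F_mul]; apply F_zero; intro x
    by_cases hx : x = 0 <;> simp [e, r, hx]
  have er : F a e * F a r = 0 := by
    rw [F_mul]; apply F_zero; intro x
    by_cases hx : x = 0 <;> simp [e, r, hx]
  have ge : F a g * F a e = 0 := by
    rw [F_mul]; apply F_zero; intro x
    by_cases hx : x = 0 <;> simp [e, g, hx]
  have eg : F a e * F a g = 0 := by
    rw [F_mul]; apply F_zero; intro x
    by_cases hx : x = 0 <;> simp [e, g, hx]
  have rg : F a r * F a g = 0 := by
    rw [F_mul]; apply F_zero; intro x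
    simp only [r, g]; split_ifs with h1 h2 <;> simp
    rcases h1 with h1 | h1 <;> linarith
  have gr : F a g * F a r = 0 := by
    rw [← rg, F_mul, F_mul]; congr 1; ext x; ring
  have rr : F a r * F a r = F a r := by
    rw [F_mul]; congr 1; ext x; simp [r]
  refine ⟨F a r + F a g * (B' * B) + W * F a e, ?_, ?_, ?_⟩
  · have t5 : F a g * (B' * B) * (B * B' * F a g) =
        F a (fun x => if -1 < x ∧ x < 0 then 1 else 0) := by
      calc F a g * (B' * B) * (B * B' * F a g) = F a g * (B' * (B * B) * B' * F a g) := by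
            simp only [Matrix.mul_assoc]
        _ = _ := by
          rw [hs, cB', Matrix.mul_assoc _ B' B', hs', F_mul, F_mul, F_mul]
          congr 1; ext x
          simp only [g]
          split_ifs with h
          · have : 1 - x * x ≠ 0 := by nlinarith [h.1, h.2]
            rw [neg_mul_neg]
            generalize 1 - x * x = y at this ⊢
            field_simp
          · simp
    have t9 : W * F a e * (F a e * Wᴴ) = F a e := by
      rw [Matrix.mul_assoc, ← Matrix.mul_assoc (F a e), ee, ← Matrix.mul_assoc, we,
        Matrix.mul_assoc, w2, Matrix.mul_one]
    have t2 : F a r * (B * B' * F a g) = 0 := by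
      rw [cBB', ← Matrix.mul_assoc, rg, Matrix.zero_mul]
    have t3 : F a r * (F a e * Wᴴ) = 0 := by rw [← Matrix.mul_assoc, re, Matrix.zero_mul]
    have t4 : F a g * (B' * B) * F a r = 0 := by
      rw [Matrix.mul_assoc, cBB, ← Matrix.mul_assoc, gr, Matrix.zero_mul]
    have t6 : F a g * (B' * B) * (F a e * Wᴴ) = 0 := by
      rw [← Matrix.mul_assoc, Matrix.mul_assoc (F a g), cBB, ← Matrix.mul_assoc, ge,
        Matrix.zero_mul, Matrix.zero_mul]
    have t7 : W * F a e * F a r = 0 := by rw [Matrix.mul_assoc, er, Matrix.mul_zero]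
    have t8 : W * F a e * (B * B' * F a g) = 0 := by
      rw [cBB', Matrix.mul_assoc, ← Matrix.mul_assoc (F a e), eg, Matrix.zero_mul, Matrix.mul_zero]
    simp only [conjTranspose_add, conjTranspose_mul, F_star, hB.eq, hB'.eq, Matrix.mul_add,
      Matrix.add_mul, t2, t3, t4, t5, t6, t7, t8, t9, rr, add_zero, zero_add]
    simp only [F, diagonal_add]
    rw [← diagonal_one]
    congr 1; ext i
    rw [← Complex.ofReal_add, ← Complex.ofReal_add, ← Complex.ofReal_one]
    congr 1
    simp only [r, e]
    rcases lt_trichotomy (a i) 0 with h | h | h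
    · by_cases h' : a i ≤ -1
      · simp [h', not_lt.2 h', h.ne]
      · simp [h', not_le.1 h', h, h.ne, h.le]
    · simp [h]
    · simp [h, h.ne', h.le]
  · have d1 : F a e * F a (fun x => x) = F a (fun x => x) * F a e := by
      rw [F_mul, F_mul]; congr 1; ext x; ring
    have d0 : F a e * F a (fun x => x) = 0 := by
      rw [F_mul]; apply F_zero; intro x
      by_cases hx : x = 0 <;> simp [e, hx]
    have d2 : ∀ f, F a f * F a (fun x => x) = F a (fun x => x) * F a f := by
      intro f; rw [F_mul, F_mul]; congr 1; ext x; ring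
    rw [Matrix.add_mul, Matrix.add_mul, Matrix.mul_add, Matrix.mul_add, d2, Matrix.mul_assoc W,
      d0, we, ← Matrix.mul_assoc _ (F a e), ← d1, d0, Matrix.mul_assoc, cBB, ← Matrix.mul_assoc,
      d2, Matrix.mul_assoc]
    simp
  · have u3 : W * F a e * B = B' * (W * F a e) := by
      rw [Matrix.mul_assoc, w3, we, ← Matrix.mul_assoc, eB']
    have u2 : F a g * (B' * B) * B = F a (fun x => g x * (1 - x * x)) * B' := by
      rw [Matrix.mul_assoc, Matrix.mul_assoc B', hs, cB', F_mul']
      congr 2; ext x; ring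
    have u2' : B' * (F a g * (B' * B)) = F a (fun x => g (-x) * (1 - x * x)) * B := by
      rw [← Matrix.mul_assoc, cB', ← Matrix.mul_assoc, Matrix.mul_assoc _ B' B', hs', F_mul]
    have u1' : B' * F a r = F a (fun x => r (-x)) * B' := cB' r
    rw [Matrix.add_mul, Matrix.add_mul, Matrix.mul_add, Matrix.mul_add, u3, u2, u2', u1']
    congr 1
    have v1 : F a r * B = F a (fun x => g (-x) * (1 - x * x)) * B := by
      rw [← sub_eq_zero, ← Matrix.sub_mul,
        show F a r - F a (fun x => g (-x) * (1 - x * x)) =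
          F a (fun x => r x - g (-x) * (1 - x * x)) by simp [F]]
      apply bdry B hB hs
      intro x h1 h2
      simp only [r, g]
      by_cases hx1 : x = 1
      · simp [hx1]
      by_cases hx2 : x = -1
      · simp [hx2]
      have h1' : -1 < x := lt_of_le_of_ne h1 (Ne.symm hx2)
      have h2' : x < 1 := lt_of_le_of_ne h2 hx1
      have : 1 - x * x ≠ 0 := by nlinarith
      by_cases hx : 0 < x
      · have : -1 < -x ∧ -x < 0 := by constructor <;> linarith
        rw [if_pos (Or.inl hx), if_pos this, neg_mul_neg]
        rw [one_div, inv_mul_cancel₀ ‹1 - x * x ≠ 0›, sub_self, zero_mul]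
      · rw [if_neg (by rintro (h | h) <;> linarith), if_neg (by rintro ⟨_, h⟩; linarith)]
        ring
    have v2 : F a (fun x => r (-x)) * B' = F a (fun x => g x * (1 - x * x)) * B' := by
      rw [← sub_eq_zero, ← Matrix.sub_mul,
        show F a (fun x => r (-x)) - F a (fun x => g x * (1 - x * x)) =
          F a (fun x => r (-x) - g x * (1 - x * x)) by simp [F]]
      apply bdry B' hB' hs'
      intro x h1 h2
      simp only [r, g]
      by_cases hx1 : x = 1
      · simp [hx1]
      by_cases hx2 : x = -1
      · simp [hx2]
      have h1' : -1 < x := lt_of_le_of_ne h1 (Ne.symm hx2)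
      have h2' : x < 1 := lt_of_le_of_ne h2 hx1
      have : 1 - x * x ≠ 0 := by nlinarith
      by_cases hx : x < 0
      · rw [if_pos (Or.inl (by linarith)), if_pos ⟨h1', hx⟩]
        rw [one_div, inv_mul_cancel₀ ‹1 - x * x ≠ 0›, sub_self, zero_mul]
      · rw [if_neg (by rintro (h | h) <;> linarith), if_neg (by rintro ⟨_, h⟩; linarith)]
        ring
    rw [v1, v2, add_comm]

lemma main (A A' B B' : Matrix n n ℂ) (hA : A.IsHermitian) (hA' : A'.IsHermitian)
    (hB : B.IsHermitian) (hB' : B'.IsHermitian)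
    (h1 : A * B = - (B * A)) (h1' : A' * B' = - (B' * A'))
    (h2 : B * B = 1 - A * A) (h2' : B' * B' = 1 - A' * A')
    (hc : A.charpoly = A'.charpoly) (ht : B.trace = B'.trace) :
    ∃ U : Matrix n n ℂ, U * Uᴴ = 1 ∧ U * A = A' * U ∧ U * B = B' * U := by
  obtain ⟨a, V, V', v1, v2, v1', v2', e, e'⟩ := equiv_of_charpoly A A' hA hA' hc
  change A = V * F a (fun x => x) * Vᴴ at e
  change A' = V' * F a (fun x => x) * V'ᴴ at e'
  have key : ∀ (A B V : Matrix n n ℂ), B.IsHermitian → A * B = - (B * A) → B * B = 1 - A * A →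
      Vᴴ * V = 1 → V * Vᴴ = 1 → A = V * F a (fun x => x) * Vᴴ →
      (Vᴴ * B * V).IsHermitian ∧
      F a (fun x => x) * (Vᴴ * B * V) = - ((Vᴴ * B * V) * F a (fun x => x)) ∧
      (Vᴴ * B * V) * (Vᴴ * B * V) = F a (fun x => 1 - x * x) ∧ (Vᴴ * B * V).trace = B.trace := by
    intro A B V hB h1 h2 v1 v2 e
    have eF : F a (fun x => x) = Vᴴ * A * V := by
      rw [e]
      calc _ = (Vᴴ * V) * F a (fun x => x) * (Vᴴ * V) := by rw [v1]; simp
        _ = _ := by simp only [Matrix.mul_assoc]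
    have cc : ∀ X Y : Matrix n n ℂ, (Vᴴ * X * V) * (Vᴴ * Y * V) = Vᴴ * (X * Y) * V := by
      intro X Y
      calc _ = Vᴴ * X * (V * Vᴴ) * Y * V := by simp only [Matrix.mul_assoc]
        _ = _ := by rw [v2]; simp only [Matrix.mul_assoc, Matrix.one_mul]
    refine ⟨?_, ?_, ?_, ?_⟩
    · rw [Matrix.IsHermitian, conjTranspose_mul, conjTranspose_mul, conjTranspose_conjTranspose,
        hB.eq, Matrix.mul_assoc]
    · rw [eF, cc, cc, h1, Matrix.mul_neg, Matrix.neg_mul]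
    · have : F a (fun x => 1 - x * x) = 1 - F a (fun x => x) * F a (fun x => x) := by
        rw [F_mul, ← diagonal_one]; simp only [F, diagonal_sub]; simp
      rw [this, eF, cc, cc, h2, Matrix.mul_sub, Matrix.sub_mul, Matrix.mul_one, v1]
    · rw [Matrix.trace_mul_comm, ← Matrix.mul_assoc, v2, Matrix.one_mul]
  obtain ⟨k1, k2, k3, k4⟩ := key A B V hB h1 h2 v1 v2 e
  obtain ⟨k1', k2', k3', k4'⟩ := key A' B' V' hB' h1' h2' v1' v2' e'
  obtain ⟨U, u1, u2, u3⟩ := core a _ _ k1 k1' k2 k2' k3 k3' (by rw [k4, k4', ht])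
  refine ⟨V' * U * Vᴴ, ?_, ?_, ?_⟩
  · rw [conjTranspose_mul, conjTranspose_mul, conjTranspose_conjTranspose]
    calc _ = V' * (U * (Vᴴ * V) * Uᴴ) * V'ᴴ := by simp only [Matrix.mul_assoc]
      _ = 1 := by rw [v1, Matrix.mul_one, u1, Matrix.mul_one, v2']
  · rw [e, e']
    calc _ = V' * (U * (Vᴴ * V) * F a (fun x => x)) * Vᴴ := by simp only [Matrix.mul_assoc]
      _ = V' * (F a (fun x => x) * (V'ᴴ * V') * U) * Vᴴ := by
        rw [v1, v1', Matrix.mul_one, Matrix.mul_one, u2]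
      _ = _ := by simp only [Matrix.mul_assoc]
  · calc V' * U * Vᴴ * B = V' * (U * (Vᴴ * B * (V * Vᴴ))) := by
          rw [v2]; simp only [Matrix.mul_assoc, Matrix.mul_one]
      _ = V' * (U * (Vᴴ * B * V)) * Vᴴ := by simp only [Matrix.mul_assoc]
      _ = (V' * V'ᴴ) * B' * V' * U * Vᴴ := by rw [u3]; simp only [Matrix.mul_assoc]
      _ = _ := by rw [v2']; simp only [Matrix.mul_assoc, Matrix.one_mul]

lemma charpoly_of (X Y : Matrix n n ℂ)
    (h : ∀ z : ℂ, (z • (1 : Matrix n n ℂ) - X).det = (z • (1 : Matrix n n ℂ) - Y).det) :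
    X.charpoly = Y.charpoly := by
  apply Polynomial.funext
  intro z
  rw [Matrix.eval_charpoly, Matrix.eval_charpoly]
  have := h z
  simpa only [Matrix.smul_one_eq_diagonal, Matrix.scalar_apply] using this

end ProjPair


/-- Two pairs of k×k projection matrices are unitarily equivalent iff their
joint characteristic polynomials coincide. -/
theorem stmt_0 {k : ℕ} (p₁ p₂ q₁ q₂ : Matrix (Fin k) (Fin k) ℂ)
    (hp₁ : p₁.IsHermitian) (hp₁' : p₁ * p₁ = p₁)
    (hp₂ : p₂.IsHermitian) (hp₂' : p₂ * p₂ = p₂)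
    (hq₁ : q₁.IsHermitian) (hq₁' : q₁ * q₁ = q₁)
    (hq₂ : q₂.IsHermitian) (hq₂' : q₂ * q₂ = q₂) :
    (∃ U ∈ Matrix.unitaryGroup (Fin k) ℂ, U * p₁ = q₁ * U ∧ U * p₂ = q₂ * U) ↔
      ∀ z₀ z₁ z₂ : ℂ,
        (z₀ • (1 : Matrix (Fin k) (Fin k) ℂ) + z₁ • p₁ + z₂ • p₂).det =
          (z₀ • (1 : Matrix (Fin k) (Fin k) ℂ) + z₁ • q₁ + z₂ • q₂).det := by
  constructor
  · rintro ⟨U, hU, h1, h2⟩ z₀ z₁ z₂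
    have hU' : IsUnit U.det := by
      have := congrArg Matrix.det (Matrix.mem_unitaryGroup_iff.1 hU)
      rw [Matrix.det_mul, Matrix.det_one] at this
      exact IsUnit.of_mul_eq_one _ this
    have : U * (z₀ • (1 : Matrix (Fin k) (Fin k) ℂ) + z₁ • p₁ + z₂ • p₂) =
        (z₀ • (1 : Matrix (Fin k) (Fin k) ℂ) + z₁ • q₁ + z₂ • q₂) * U := by
      simp only [Matrix.mul_add, Matrix.add_mul, Matrix.mul_smul, Matrix.smul_mul, h1, h2,
        Matrix.mul_one, Matrix.one_mul]
    have := congrArg Matrix.det this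
    rw [Matrix.det_mul, Matrix.det_mul, mul_comm] at this
    exact hU'.mul_right_cancel this
  · intro h
    have hA : (p₁ - p₂).charpoly = (q₁ - q₂).charpoly := by
      apply ProjPair.charpoly_of
      intro z
      have := h z (-1) 1
      convert this using 2 <;> module
    have hB : (1 - p₁ - p₂).trace = (1 - q₁ - q₂).trace := by
      have : (p₁ + p₂).charpoly = (q₁ + q₂).charpoly := by
        apply ProjPair.charpoly_of
        intro z
        have := h z (-1) (-1)
        convert this using 2 <;> module
      have : (p₁ + p₂).trace = (q₁ + q₂).trace := by
        rw [Matrix.trace_eq_sum_roots_charpoly, Matrix.trace_eq_sum_roots_charpoly, this]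
      rw [sub_sub, sub_sub, Matrix.trace_sub, this, Matrix.trace_sub]
    obtain ⟨U, u1, u2, u3⟩ := ProjPair.main (p₁ - p₂) (q₁ - q₂) (1 - p₁ - p₂) (1 - q₁ - q₂)
      (hp₁.sub hp₂) (hq₁.sub hq₂) ((Matrix.isHermitian_one.sub hp₁).sub hp₂)
      ((Matrix.isHermitian_one.sub hq₁).sub hq₂)
      (by noncomm_ring; simp only [hp₁', hp₂']; abel)
      (by noncomm_ring; simp only [hq₁', hq₂']; abel)
      (by noncomm_ring; simp only [hp₁', hp₂']; abel)
      (by noncomm_ring; simp only [hq₁', hq₂']; abel) hA hB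
    have u3' : U * (p₁ + p₂) = (q₁ + q₂) * U := by
      simp only [Matrix.mul_sub, Matrix.sub_mul, Matrix.mul_one, Matrix.one_mul] at u3
      rw [Matrix.mul_add, Matrix.add_mul]
      rw [sub_sub, sub_sub] at u3
      exact sub_right_injective u3
    rw [Matrix.mul_sub, Matrix.sub_mul] at u2
    rw [Matrix.mul_add, Matrix.add_mul] at u3'
    refine ⟨U, Matrix.mem_unitaryGroup_iff.2 u1, ?_, ?_⟩
    · linear_combination (norm := module) (1 / 2 : ℂ) • u2 + (1 / 2 : ℂ) • u3'
    · linear_combination (norm := module) (1 / 2 : ℂ) • u3' - (1 / 2 : ℂ) • u2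
end

section
/- Two pairs of k×k projection matrices (p₁, p₂) and (q₁, q₂) are unitarily equivalent if and only if tr(p₁) = tr(q₁), tr(p₂) = tr(q₂), and tr[(p₁p₂)ʲ] = tr[(q₁q₂)ʲ] for all j ≥ 1. -/
open Matrix in
/-- Matrices with the same Gram matrix differ by a unitary. -/
lemma exists_unitary_of_gram_eq {m n : Type} [Fintype m] [DecidableEq m] [Fintype n]
    [DecidableEq n] (A B : Matrix m n ℂ) (h : Aᴴ * A = Bᴴ * B) :
    ∃ U ∈ Matrix.unitaryGroup m ℂ, U * A = B := by
  have hnorm : ∀ x : EuclideanSpace ℂ n,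
      ‖Matrix.toEuclideanLin A x‖ = ‖Matrix.toEuclideanLin B x‖ := by
    have key : ∀ (C : Matrix m n ℂ) (x : EuclideanSpace ℂ n),
        inner ℂ (Matrix.toEuclideanLin C x) (Matrix.toEuclideanLin C x) =
          star x.ofLp ⬝ᵥ ((Cᴴ * C) *ᵥ x.ofLp) := by
      intro C x
      rw [EuclideanSpace.inner_eq_star_dotProduct, dotProduct_comm]
      simp only [Matrix.toLpLin_apply]
      rw [Matrix.star_mulVec, ← Matrix.dotProduct_mulVec, Matrix.mulVec_mulVec]
    intro x
    have h1 := key A x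
    rw [h, ← key B x, inner_self_eq_norm_sq_to_K, inner_self_eq_norm_sq_to_K] at h1
    have h2 : ‖Matrix.toEuclideanLin A x‖ ^ 2 = ‖Matrix.toEuclideanLin B x‖ ^ 2 := by
      exact_mod_cast h1
    exact (sq_eq_sq₀ (norm_nonneg _) (norm_nonneg _)).1 h2
  set f := Matrix.toEuclideanLin A with hf
  set g := Matrix.toEuclideanLin B with hg
  obtain ⟨s, hs⟩ := f.rangeRestrict.exists_rightInverse_of_surjective f.range_rangeRestrict
  have hs' : ∀ y, f (s y) = y := fun y => by
    have := congrArg Subtype.val (LinearMap.congr_fun hs y)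
    simpa using this
  let L : LinearMap.range f →ₗᵢ[ℂ] EuclideanSpace ℂ m :=
    ⟨g ∘ₗ s, fun y => by
      rw [LinearMap.comp_apply, ← hnorm, hs']; rfl⟩
  have hL : ∀ x, L.extend (f x) = g x := by
    intro x
    have h1 := L.extend_apply ⟨f x, x, rfl⟩
    rw [show L.extend (f x) = _ from h1]
    change g (s ⟨f x, x, rfl⟩) = g x
    rw [← sub_eq_zero, ← map_sub, ← norm_eq_zero, ← hnorm, map_sub, hs']
    simp
  let U : Matrix m m ℂ := Matrix.toEuclideanLin.symm L.extend.toLinearMap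
  have hU : ∀ x, Matrix.toEuclideanLin U x = L.extend x := by
    intro x
    simp [U]
  refine ⟨U, ?_, ?_⟩
  · rw [Matrix.mem_unitaryGroup_iff']
    ext i j
    have h1 := L.extend.inner_map_map (EuclideanSpace.single i 1) (EuclideanSpace.single j 1)
    rw [← hU, ← hU, EuclideanSpace.inner_eq_star_dotProduct] at h1
    simp only [Matrix.toLpLin_apply] at h1
    simp [Matrix.mulVec_single, dotProduct] at h1
    simp only [Matrix.mul_apply, Matrix.star_apply, Matrix.one_apply]
    rw [← Complex.star_def] at h1
    rw [EuclideanSpace.inner_single_left] at h1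
    simpa [mul_comm, Pi.single_apply] using h1
  · apply Matrix.toEuclideanLin.injective
    refine LinearMap.ext fun x => ?_
    rw [← hg, ← hL, ← hU, hf]
    simp [Matrix.toLpLin_apply, Matrix.mulVec_mulVec]

lemma trace_pow_hermitian {n : Type} [Fintype n] [DecidableEq n] (A : Matrix n n ℂ)
    (hA : A.IsHermitian) (j : ℕ) :
    (A ^ j).trace = ∑ i, ((hA.eigenvalues i : ℝ) : ℂ) ^ j := by
  conv_lhs => rw [hA.spectral_theorem, ← map_pow, Matrix.diagonal_pow,
    Unitary.conjStarAlgAut_apply, Matrix.trace_mul_comm, ← mul_assoc]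
  simp [Matrix.trace]

/-- Equal power sums give equal products. -/
lemma prod_eq_of_power_sums {n : Type} [Fintype n] [DecidableEq n] (a b : n → ℂ)
    (h : ∀ j : ℕ, ∑ i, a i ^ j = ∑ i, b i ^ j) :
    Multiset.map a Finset.univ.val = Multiset.map b Finset.univ.val := by
  classical
  have hpoly : ∀ f : Polynomial ℂ, ∑ i, f.eval (a i) = ∑ i, f.eval (b i) := by
    intro f
    simp only [Polynomial.eval_eq_sum_range]
    rw [Finset.sum_comm, Finset.sum_comm (s := Finset.univ)]
    refine Finset.sum_congr rfl fun j _ => ?_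
    rw [← Finset.mul_sum, ← Finset.mul_sum, h]
  ext c
  let S := Finset.univ.image a ∪ Finset.univ.image b
  let f : Polynomial ℂ := ∏ d ∈ S.erase c, (Polynomial.X - Polynomial.C d)
  have hfc : f.eval c ≠ 0 := by
    simp only [f, Polynomial.eval_prod, Polynomial.eval_sub, Polynomial.eval_X, Polynomial.eval_C]
    refine Finset.prod_ne_zero_iff.2 fun d hd => sub_ne_zero.2 (Finset.ne_of_mem_erase hd).symm
  have hfd : ∀ d ∈ S, f.eval d = if c = d then f.eval c else 0 := by
    intro d hd
    split_ifs with hcd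
    · rw [hcd]
    · simp only [f, Polynomial.eval_prod, Polynomial.eval_sub, Polynomial.eval_X,
        Polynomial.eval_C]
      exact Finset.prod_eq_zero (Finset.mem_erase.2 ⟨Ne.symm hcd, hd⟩) (sub_self _)
  have h1 := hpoly f
  rw [Finset.sum_congr rfl (fun i _ => hfd (a i) (by simp [S])),
    Finset.sum_congr rfl (fun i _ => hfd (b i) (by simp [S])),
    ← Finset.sum_filter, ← Finset.sum_filter, Finset.sum_const, Finset.sum_const,
    nsmul_eq_mul, nsmul_eq_mul] at h1
  have h2 := mul_right_cancel₀ hfc h1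
  rw [Multiset.count_map, Multiset.count_map]
  exact_mod_cast h2

/-- Hermitian matrices with equal traces of powers are unitarily equivalent. -/
lemma hermitian_unitary_equiv {n : Type} [Fintype n] [DecidableEq n] (A B : Matrix n n ℂ)
    (hA : A.IsHermitian) (hB : B.IsHermitian)
    (h : ∀ j : ℕ, 1 ≤ j → (A ^ j).trace = (B ^ j).trace) :
    ∃ W ∈ Matrix.unitaryGroup n ℂ, star W * A * W = B := by
  have hev : hA.eigenvalues = hB.eigenvalues := by
    rw [Matrix.IsHermitian.eigenvalues_eq_eigenvalues_iff, hA.charpoly_eq, hB.charpoly_eq]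
    have := prod_eq_of_power_sums (fun i => (hA.eigenvalues i : ℂ)) (fun i => (hB.eigenvalues i : ℂ))
      (fun j => by
        rcases Nat.eq_zero_or_pos j with rfl | hj
        · simp
        · have := h j hj
          rwa [trace_pow_hermitian A hA, trace_pow_hermitian B hB] at this)
    have h2 := congrArg (fun s => (Multiset.map (fun z => Polynomial.X - Polynomial.C z) s).prod) this
    simpa only [Multiset.map_map] using! h2
  have h1 := hA.conjStarAlgAut_star_eigenvectorUnitary
  have h2 := hB.spectral_theorem
  rw [← hev, ← h1, ← Unitary.conjStarAlgAut_mul_apply, Unitary.conjStarAlgAut_apply] at h2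
  refine ⟨(star (hB.eigenvectorUnitary * star hA.eigenvectorUnitary) : Matrix.unitaryGroup n ℂ),
    Subtype.property _, ?_⟩
  conv_rhs => rw [h2]
  simp [mul_assoc]

open Matrix in
/-- A projection factors through an isometry. -/
lemma projection_factor {n : Type} [Fintype n] [DecidableEq n] (p : Matrix n n ℂ)
    (hp : p.IsHermitian) (hp' : p * p = p) :
    ∃ (r : ℕ) (X : Matrix n (Fin r) ℂ), X * Xᴴ = p ∧ Xᴴ * X = 1 := by
  classical
  have h1 := hp.conjStarAlgAut_star_eigenvectorUnitary
  have hidem : ∀ i, hp.eigenvalues i = 0 ∨ hp.eigenvalues i = 1 := by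
    have h2 := congrArg (Unitary.conjStarAlgAut ℂ _ (star hp.eigenvectorUnitary)) hp'
    rw [map_mul, h1, Matrix.diagonal_mul_diagonal] at h2
    intro i
    have h3 := congrFun (Matrix.diagonal_injective h2) i
    have h4 : hp.eigenvalues i * hp.eigenvalues i = hp.eigenvalues i := by
      simp only [Function.comp] at h3
      exact_mod_cast h3
    rcases eq_or_ne (hp.eigenvalues i) 0 with h | h
    · exact Or.inl h
    · exact Or.inr (mul_left_cancel₀ h (by rw [h4, mul_one]))
  let V : Matrix n n ℂ := hp.eigenvectorUnitary
  have hV : Vᴴ * V = 1 := Matrix.mem_unitaryGroup_iff'.1 hp.eigenvectorUnitary.2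
  have hs := hp.spectral_theorem
  rw [Unitary.conjStarAlgAut_apply] at hs
  let T := {i // hp.eigenvalues i = 1}
  let e : Fin (Fintype.card T) ≃ T := (Fintype.equivFin T).symm
  refine ⟨Fintype.card T, V.submatrix id (fun i => (e i : n)), ?_, ?_⟩
  · conv_rhs => rw [hs]
    ext i j
    rw [Matrix.mul_apply, Matrix.mul_apply]
    simp only [Matrix.submatrix_apply, Matrix.conjTranspose_apply,
      Matrix.mul_diagonal, id, Matrix.star_apply, Function.comp]
    rw [e.sum_comp (fun t : T => V i t * star (V j t)),
      ← Finset.sum_subtype (Finset.univ.filter fun i => hp.eigenvalues i = 1) (by simp)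
        (fun t => V i t * star (V j t)), Finset.sum_filter]
    refine Finset.sum_congr rfl fun l _ => ?_
    rcases hidem l with h | h <;> simp [h, V]
  · have h2 : (Vᴴ * V).submatrix (fun i => (e i : n)) (fun i => (e i : n)) = 1 := by
      rw [hV]
      exact Matrix.submatrix_one _ (Subtype.val_injective.comp e.injective)
    rw [← h2]
    ext i j
    simp [Matrix.mul_apply]

open Matrix in
/-- Two pairs of projections are unitarily equivalent iff the traces of
p₁, p₂ and of all powers (p₁p₂)ʲ, j ≥ 1, agree. -/
theorem stmt_1 {k : ℕ} (p₁ p₂ q₁ q₂ : Matrix (Fin k) (Fin k) ℂ)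
    (hp₁ : p₁.IsHermitian) (hp₁' : p₁ * p₁ = p₁)
    (hp₂ : p₂.IsHermitian) (hp₂' : p₂ * p₂ = p₂)
    (hq₁ : q₁.IsHermitian) (hq₁' : q₁ * q₁ = q₁)
    (hq₂ : q₂.IsHermitian) (hq₂' : q₂ * q₂ = q₂) :
    (∃ U ∈ Matrix.unitaryGroup (Fin k) ℂ, U * p₁ = q₁ * U ∧ U * p₂ = q₂ * U) ↔
      (p₁.trace = q₁.trace ∧ p₂.trace = q₂.trace ∧
        ∀ j : ℕ, 1 ≤ j → ((p₁ * p₂) ^ j).trace = ((q₁ * q₂) ^ j).trace) := by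
  constructor
  · rintro ⟨U, hU, h1, h2⟩
    have hU' := Matrix.mem_unitaryGroup_iff'.1 hU
    have hU'' := Matrix.mem_unitaryGroup_iff.1 hU
    have key : ∀ a b : Matrix (Fin k) (Fin k) ℂ, U * a = b * U → a.trace = b.trace := by
      intro a b hab
      have : a = star U * (b * U) := by rw [← hab, ← mul_assoc, hU', one_mul]
      rw [this, Matrix.trace_mul_comm, mul_assoc, hU'', mul_one]
    refine ⟨key _ _ h1, key _ _ h2, fun j _ => key _ _ ?_⟩
    have h12 : SemiconjBy U (p₁ * p₂) (q₁ * q₂) := SemiconjBy.mul_right h1 h2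
    exact h12.pow_right j
  · rintro ⟨t1, t2, t3⟩
    have rk : ∀ (r : ℕ) (X : Matrix (Fin k) (Fin r) ℂ), Xᴴ * X = 1 → (X * Xᴴ).trace = r := by
      intro r X hX
      rw [Matrix.trace_mul_comm, hX]; simp
    obtain ⟨r, X, rfl, hX⟩ := projection_factor p₁ hp₁ hp₁'
    obtain ⟨s, Y, rfl, hY⟩ := projection_factor p₂ hp₂ hp₂'
    obtain ⟨r', X', rfl, hX'⟩ := projection_factor q₁ hq₁ hq₁'
    obtain ⟨s', Y', rfl, hY'⟩ := projection_factor q₂ hq₂ hq₂'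
    rw [rk _ _ hX, rk _ _ hX'] at t1
    rw [rk _ _ hY, rk _ _ hY'] at t2
    obtain rfl : r = r' := by exact_mod_cast t1
    obtain rfl : s = s' := by exact_mod_cast t2
    have tp : ∀ (X : Matrix (Fin k) (Fin r) ℂ) (Y : Matrix (Fin k) (Fin s) ℂ), Xᴴ * X = 1 →
        ∀ j : ℕ, ((X * Xᴴ * (Y * Yᴴ)) ^ (j + 1)).trace =
          (((Xᴴ * Y) * (Xᴴ * Y)ᴴ) ^ (j + 1)).trace := by
      intro X Y hX j
      have : ∀ j : ℕ, (X * Xᴴ * (Y * Yᴴ)) ^ (j + 1) =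
          X * ((Xᴴ * Y) * (Xᴴ * Y)ᴴ) ^ j * (Xᴴ * Y * Yᴴ) := by
        intro j
        induction j with
        | zero => simp [Matrix.mul_assoc]
        | succ j ih =>
          rw [pow_succ, ih, pow_succ]
          simp only [Matrix.conjTranspose_mul, Matrix.conjTranspose_conjTranspose,
            Matrix.mul_assoc]
      rw [this, Matrix.mul_assoc, Matrix.trace_mul_comm, pow_succ]
      simp only [Matrix.conjTranspose_mul, Matrix.conjTranspose_conjTranspose, Matrix.mul_assoc]
    obtain ⟨W, hW, hWM⟩ := hermitian_unitary_equiv ((Xᴴ * Y) * (Xᴴ * Y)ᴴ)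
      ((X'ᴴ * Y') * (X'ᴴ * Y')ᴴ) (Matrix.isHermitian_mul_conjTranspose_self _)
      (Matrix.isHermitian_mul_conjTranspose_self _) (by
        intro j hj
        obtain ⟨j, rfl⟩ := Nat.exists_eq_add_of_le' hj
        rw [← tp X Y hX, ← tp X' Y' hX']
        exact t3 _ hj)
    obtain ⟨Z, hZ, hZM⟩ := exists_unitary_of_gram_eq ((Xᴴ * Y)ᴴ * W) (X'ᴴ * Y')ᴴ (by
      rw [Matrix.conjTranspose_conjTranspose, ← hWM, Matrix.star_eq_conjTranspose]
      simp only [Matrix.conjTranspose_mul, Matrix.conjTranspose_conjTranspose, Matrix.mul_assoc])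
    have hW1 : Wᴴ * W = 1 := Matrix.mem_unitaryGroup_iff'.1 hW
    have hW2 : W * Wᴴ = 1 := Matrix.mem_unitaryGroup_iff.1 hW
    have hZ1 : Zᴴ * Z = 1 := Matrix.mem_unitaryGroup_iff'.1 hZ
    have hZ2 : Z * Zᴴ = 1 := Matrix.mem_unitaryGroup_iff.1 hZ
    have a1 : (X * W)ᴴ * (X * W) = 1 := by
      rw [Matrix.conjTranspose_mul, Matrix.mul_assoc, ← Matrix.mul_assoc Xᴴ, hX, Matrix.one_mul, hW1]
    have a2 : (Y * Zᴴ)ᴴ * (Y * Zᴴ) = 1 := by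
      rw [Matrix.conjTranspose_mul, Matrix.mul_assoc, ← Matrix.mul_assoc Yᴴ, hY, Matrix.one_mul,
        Matrix.conjTranspose_conjTranspose, hZ2]
    have a3 : (Y * Zᴴ)ᴴ * (X * W) = Y'ᴴ * X' := by
      simpa [Matrix.conjTranspose_mul, Matrix.mul_assoc] using hZM
    have a4 : (X * W)ᴴ * (Y * Zᴴ) = X'ᴴ * Y' := by
      simpa [Matrix.conjTranspose_mul, Matrix.mul_assoc] using congrArg Matrix.conjTranspose a3
    obtain ⟨U, hU, hUA⟩ := exists_unitary_of_gram_eq (Matrix.fromCols (X * W) (Y * Zᴴ))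
      (Matrix.fromCols X' Y') (by
        rw [Matrix.conjTranspose_fromCols_eq_fromRows_conjTranspose,
          Matrix.conjTranspose_fromCols_eq_fromRows_conjTranspose,
          Matrix.fromRows_mul_fromCols, Matrix.fromRows_mul_fromCols, a1, a2, a3, a4, hX', hY'])
    rw [Matrix.mul_fromCols] at hUA
    obtain ⟨u1, u2⟩ := Matrix.fromCols_inj hUA
    have hU1 : Uᴴ * U = 1 := Matrix.mem_unitaryGroup_iff'.1 hU
    refine ⟨U, hU, ?_, ?_⟩
    · have : X * Xᴴ = (X * W) * (X * W)ᴴ := by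
        rw [Matrix.conjTranspose_mul, Matrix.mul_assoc, ← Matrix.mul_assoc W, hW2, Matrix.one_mul]
      rw [this, ← u1, Matrix.conjTranspose_mul U]
      simp only [Matrix.mul_assoc, hU1, Matrix.mul_one]
    · have : Y * Yᴴ = (Y * Zᴴ) * (Y * Zᴴ)ᴴ := by
        rw [Matrix.conjTranspose_mul, Matrix.mul_assoc, ← Matrix.mul_assoc Zᴴ,
          Matrix.conjTranspose_conjTranspose, hZ1, Matrix.one_mul]
      rw [this, ← u2, Matrix.conjTranspose_mul U]
      simp only [Matrix.mul_assoc, hU1, Matrix.mul_one]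
end

section
/- Two pairs of k×k projection matrices (p₁, p₂) and (q₁, q₂) are unitarily equivalent if and only if tr(p₁) = tr(q₁), tr(p₂) = tr(q₂), and tr[(p₁p₂)ʲ] = tr[(q₁q₂)ʲ] for all 1 ≤ j ≤ k−1 (by the Cayley–Hamilton theorem, the trace conditions for j ≥ k are automatic). -/
open Matrix

lemma newton_aux {a : ℕ} (x y : Fin a → ℂ)
    (h : ∀ j, 1 ≤ j → j ≤ a → ∑ i, x i ^ j = ∑ i, y i ^ j) (n : ℕ) (hn : n ≤ a) :
    MvPolynomial.aeval x (MvPolynomial.esymm (Fin a) ℂ n) =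
      MvPolynomial.aeval y (MvPolynomial.esymm (Fin a) ℂ n) := by
  induction n using Nat.strong_induction_on with
  | _ n ih =>
    rcases Nat.eq_zero_or_pos n with rfl | hpos
    · simp
    have hx := congrArg (MvPolynomial.aeval x) (MvPolynomial.mul_esymm_eq_sum (Fin a) ℂ n)
    have hy := congrArg (MvPolynomial.aeval y) (MvPolynomial.mul_esymm_eq_sum (Fin a) ℂ n)
    simp only [map_mul, map_natCast, map_sum, map_pow, map_neg, map_one] at hx hy
    have hn0 : (n : ℂ) ≠ 0 := by exact_mod_cast hpos.ne'
    apply mul_left_cancel₀ hn0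
    rw [hx, hy]
    congr 1
    apply Finset.sum_congr rfl
    intro b hb
    rw [Finset.mem_filter, Finset.HasAntidiagonal.mem_antidiagonal] at hb
    obtain ⟨hb1, hb2⟩ := hb
    rw [ih b.1 hb2 (by omega)]
    congr 1
    simp only [MvPolynomial.psum, map_sum, map_pow, MvPolynomial.aeval_X]
    exact h _ (by omega) (by omega)

lemma prod_eq_aux {a : ℕ} (x y : Fin a → ℂ)
    (h : ∀ j, 1 ≤ j → j ≤ a → ∑ i, x i ^ j = ∑ i, y i ^ j) :
    ∏ i, (Polynomial.X - Polynomial.C (x i)) = ∏ i, (Polynomial.X - Polynomial.C (y i)) := by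
  have key : ∀ z : Fin a → ℂ, ∏ i, (Polynomial.X - Polynomial.C (z i)) =
      ∑ j ∈ Finset.range (a + 1), (-1) ^ j * (Polynomial.C (MvPolynomial.aeval z (MvPolynomial.esymm (Fin a) ℂ j)) * Polynomial.X ^ (a - j)) := by
    intro z
    have := Multiset.prod_X_sub_X_eq_sum_esymm (Finset.univ.val.map z)
    simp only [MvPolynomial.aeval_esymm_eq_multiset_esymm]
    simpa [Multiset.map_map, Function.comp_def, Finset.prod] using this
  rw [key, key]
  apply Finset.sum_congr rfl
  intro j hj
  rw [newton_aux x y h j (by simpa [Nat.lt_succ_iff] using hj)]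

lemma spec_aux {a : ℕ} (A : Matrix (Fin a) (Fin a) ℂ) (hA : A.IsHermitian) :
    ∃ Q ∈ unitaryGroup (Fin a) ℂ, A = Q * diagonal (fun i => (hA.eigenvalues i : ℂ)) * Qᴴ := by
  refine ⟨hA.eigenvectorUnitary, hA.eigenvectorUnitary.2, ?_⟩
  have := hA.spectral_theorem
  rw [Unitary.conjStarAlgAut_apply] at this
  exact this

lemma conj_pow_aux {a : ℕ} (Q D : Matrix (Fin a) (Fin a) ℂ) (hQ : Qᴴ * Q = 1) (j : ℕ) (hj : 1 ≤ j) :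
    (Q * D * Qᴴ) ^ j = Q * D ^ j * Qᴴ := by
  induction j, hj using Nat.le_induction with
  | base => simp
  | succ n hn ih =>
    rw [pow_succ, ih, pow_succ]
    calc _ = Q * D ^ n * (Qᴴ * Q) * D * Qᴴ := by noncomm_ring
      _ = _ := by rw [hQ]; noncomm_ring

lemma herm_equiv {a : ℕ} (A B : Matrix (Fin a) (Fin a) ℂ) (hA : A.IsHermitian)
    (hB : B.IsHermitian) (h : ∀ j, 1 ≤ j → j ≤ a → (A ^ j).trace = (B ^ j).trace) :
    ∃ X ∈ unitaryGroup (Fin a) ℂ, X * A * Xᴴ = B := by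
  obtain ⟨Q, hQ, eA⟩ := spec_aux A hA
  obtain ⟨R, hR, eB⟩ := spec_aux B hB
  have hQ1 : Qᴴ * Q = 1 := mem_unitaryGroup_iff'.1 hQ
  have hR1 : Rᴴ * R = 1 := mem_unitaryGroup_iff'.1 hR
  have tr : ∀ (C Q : Matrix (Fin a) (Fin a) ℂ) (d : Fin a → ℂ), Qᴴ * Q = 1 →
      C = Q * diagonal d * Qᴴ → ∀ j, 1 ≤ j → (C ^ j).trace = ∑ i, d i ^ j := by
    intro C Q d hQ hC j hj
    rw [hC, conj_pow_aux _ _ hQ j hj, trace_mul_comm, ← mul_assoc, hQ, one_mul, diagonal_pow,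
      trace_diagonal]
    rfl
  have hev : hA.eigenvalues = hB.eigenvalues := by
    rw [hA.eigenvalues_eq_eigenvalues_iff hB, hA.charpoly_eq, hB.charpoly_eq]
    apply prod_eq_aux
    intro j h1 h2
    have := h j h1 h2
    rw [tr A Q _ hQ1 eA j h1, tr B R _ hR1 eB j h1] at this
    exact this
  refine ⟨R * Qᴴ, mul_mem hR (Unitary.star_mem hQ), ?_⟩
  rw [hev] at eA
  rw [conjTranspose_mul, conjTranspose_conjTranspose]
  conv_lhs => rw [eA]
  conv_rhs => rw [eB]
  calc _ = R * (Qᴴ * Q) * diagonal (fun i => (hB.eigenvalues i : ℂ)) * (Qᴴ * Q) * Rᴴ := by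
        simp only [mul_assoc]
    _ = _ := by rw [hQ1]; simp only [mul_one]

lemma proj_decomp {k : ℕ} (p : Matrix (Fin k) (Fin k) ℂ) (hp : p.IsHermitian) (hp' : p * p = p) :
    ∃ (a : ℕ) (V : Matrix (Fin k) (Fin a) ℂ), Vᴴ * V = 1 ∧ V * Vᴴ = p := by
  obtain ⟨Q, hQ, eA⟩ := spec_aux p hp
  have hQ1 : Qᴴ * Q = 1 := mem_unitaryGroup_iff'.1 hQ
  set d : Fin k → ℂ := fun i => (hp.eigenvalues i : ℂ) with hd
  have hD : diagonal d = Qᴴ * p * Q := by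
    rw [eA]
    calc _ = (Qᴴ * Q) * diagonal d * (Qᴴ * Q) := by rw [hQ1]; simp
      _ = _ := by noncomm_ring
  have hDD : diagonal d * diagonal d = diagonal d := by
    have h2 := conj_pow_aux Q (diagonal d) hQ1 2 (by norm_num)
    rw [← eA, pow_two, hp', pow_two] at h2
    calc _ = (Qᴴ * Q) * (diagonal d * diagonal d) * (Qᴴ * Q) := by rw [hQ1]; simp
      _ = Qᴴ * (Q * (diagonal d * diagonal d) * Qᴴ) * Q := by noncomm_ring
      _ = _ := by rw [← h2, hD]
  have hd01 : ∀ i, d i = 0 ∨ d i = 1 := by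
    intro i
    have := congrFun (congrFun hDD i) i
    simp only [diagonal_mul_diagonal, diagonal_apply_eq] at this
    by_cases h0 : d i = 0
    · exact Or.inl h0
    · exact Or.inr (mul_left_cancel₀ h0 (by simpa using this))
  classical
  let e := (Fintype.equivFin {i // d i = 1}).symm
  refine ⟨_, Q.submatrix id (fun j => (e j : Fin k)), ?_, ?_⟩
  · ext x y
    have := congrFun (congrFun hQ1 (e x)) (e y)
    rw [mul_apply] at this ⊢
    simp only [submatrix_apply, conjTranspose_apply, id] at this ⊢
    rw [this, one_apply, one_apply]
    simp [Subtype.val_inj]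
  · ext x y
    rw [eA, mul_apply, mul_apply]
    simp only [mul_diagonal, submatrix_apply, conjTranspose_apply, id]
    rw [Equiv.sum_comp e (fun i => Q x i * star (Q y i))]
    rw [← Finset.sum_subtype (Finset.univ.filter fun i => d i = 1) (by simp) (fun i => Q x i * star (Q y i)), Finset.sum_filter]
    apply Finset.sum_congr rfl
    intro i _
    rcases hd01 i with h | h <;> simp [h]

lemma isom_unitary {n : ℕ} (T : EuclideanSpace ℂ (Fin n) →ₗᵢ[ℂ] EuclideanSpace ℂ (Fin n)) :
    ∃ U ∈ unitaryGroup (Fin n) ℂ, ∀ x, toEuclideanLin U x = T x := by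
  obtain ⟨U, hU'⟩ := toEuclideanLin.surjective T.toLinearMap
  have hU : ∀ x, toEuclideanLin U x = T x := by
    intro x; rw [hU']; rfl
  refine ⟨U, ?_, hU⟩
  rw [mem_unitaryGroup_iff']
  ext i j
  have h1 := T.inner_map_map (EuclideanSpace.single i (1:ℂ)) (EuclideanSpace.single j 1)
  rw [← hU, ← hU] at h1
  have hcol : ∀ j i, (toEuclideanLin U (EuclideanSpace.single j (1:ℂ))).ofLp i = U i j := by
    intro j i
    simp [toLpLin_apply]
  rw [PiLp.inner_apply] at h1
  simp only [hcol] at h1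
  rw [mul_apply, one_apply]
  simp only [star_apply]
  calc _ = ∑ x, inner ℂ (U x i) (U x j) := by
        apply Finset.sum_congr rfl
        intro x _
        simp [mul_comm]
    _ = _ := by
        rw [h1, EuclideanSpace.inner_single_left]
        simp [Pi.single_apply]

lemma gram_aux {n : ℕ} {m : Type} [Fintype m] [DecidableEq m] (A B : Matrix (Fin n) m ℂ)
    (h : Aᴴ * A = Bᴴ * B) : ∃ U ∈ unitaryGroup (Fin n) ℂ, U * A = B := by
  let f := toEuclideanLin A
  let g := toEuclideanLin B
  have hinner : ∀ (C : Matrix (Fin n) m ℂ) x, ((‖toEuclideanLin C x‖ ^ 2 : ℝ) : ℂ) =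
      star x.ofLp ⬝ᵥ ((Cᴴ * C) *ᵥ x.ofLp) := by
    intro C x
    have := inner_self_eq_norm_sq_to_K (𝕜 := ℂ) (toEuclideanLin C x)
    push_cast
    rw [← mulVec_mulVec, dotProduct_mulVec, ← star_mulVec]
    rw [EuclideanSpace.inner_eq_star_dotProduct] at this
    rw [dotProduct_comm]
    exact this.symm
  have hnorm : ∀ x, ‖f x‖ = ‖g x‖ := by
    intro x
    have h1 := hinner A x
    rw [h, ← hinner B x] at h1
    have h2 : ‖f x‖ ^ 2 = ‖g x‖ ^ 2 := by exact_mod_cast h1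
    exact (sq_eq_sq₀ (norm_nonneg _) (norm_nonneg _)).1 h2
  obtain ⟨s, hs⟩ := LinearMap.exists_rightInverse_of_surjective f.rangeRestrict f.range_rangeRestrict
  have hs' : ∀ y, f (s y) = y := fun y => congrArg Subtype.val (LinearMap.congr_fun hs y)
  let L : LinearMap.range f →ₗᵢ[ℂ] EuclideanSpace ℂ (Fin n) :=
    ⟨g ∘ₗ s, fun y => by
      change ‖g (s y)‖ = ‖y‖
      rw [← hnorm, hs']; rfl⟩
  have hL : ∀ x, L.extend (f x) = g x := by
    intro x
    have h1 := L.extend_apply ⟨f x, ⟨x, rfl⟩⟩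
    change L.extend (f x) = g (s ⟨f x, ⟨x, rfl⟩⟩) at h1
    rw [h1, ← sub_eq_zero, ← map_sub, ← norm_eq_zero, ← hnorm, map_sub, hs', sub_self, norm_zero]
  obtain ⟨U, hU1, hU⟩ := isom_unitary L.extend
  refine ⟨U, hU1, ?_⟩
  apply toEuclideanLin.injective
  apply LinearMap.ext
  intro x
  have := hL x
  rw [← hU] at this
  change _ = g x
  rw [← this]
  simp [f, toLpLin_apply]

lemma col_trace {k a : ℕ} (V : Matrix (Fin k) (Fin a) ℂ) (h : Vᴴ * V = 1) :
    (V * Vᴴ).trace = a := by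
  rw [trace_mul_comm, h]; simp

lemma pow_trace {k a : ℕ} (V : Matrix (Fin k) (Fin a) ℂ) (p : Matrix (Fin k) (Fin k) ℂ)
    (j : ℕ) (hj : 1 ≤ j) :
    ((Vᴴ * p * V) ^ j).trace = ((V * Vᴴ * p) ^ j).trace := by
  have key : ∀ n : ℕ, (Vᴴ * p * V) ^ (n + 1) = Vᴴ * p * (V * Vᴴ * p) ^ n * V := by
    intro n
    induction n with
    | zero => simp
    | succ n ih => rw [pow_succ, ih, pow_succ]; simp only [Matrix.mul_assoc]
  obtain ⟨n, rfl⟩ : ∃ n, j = n + 1 := ⟨j - 1, by omega⟩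
  rw [key, trace_mul_comm, pow_succ']
  simp only [Matrix.mul_assoc]

lemma main_aux {k a b : ℕ} (V₁ W₁ : Matrix (Fin k) (Fin a) ℂ) (V₂ W₂ : Matrix (Fin k) (Fin b) ℂ)
    (hV₁ : V₁ᴴ * V₁ = 1) (hV₂ : V₂ᴴ * V₂ = 1) (hW₁ : W₁ᴴ * W₁ = 1) (hW₂ : W₂ᴴ * W₂ = 1)
    (h : ∀ j, 1 ≤ j → j ≤ a →
      ((V₁ * V₁ᴴ * (V₂ * V₂ᴴ)) ^ j).trace = ((W₁ * W₁ᴴ * (W₂ * W₂ᴴ)) ^ j).trace) :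
    ∃ U ∈ unitaryGroup (Fin k) ℂ, U * (V₁ * V₁ᴴ) = W₁ * W₁ᴴ * U ∧
      U * (V₂ * V₂ᴴ) = W₂ * W₂ᴴ * U := by
  have hh : ∀ (V : Matrix (Fin k) (Fin a) ℂ) (W : Matrix (Fin k) (Fin b) ℂ),
      (Vᴴ * (W * Wᴴ) * V).IsHermitian := by
    intro V W
    simp [IsHermitian, conjTranspose_mul, Matrix.mul_assoc]
  obtain ⟨X, hX, eX⟩ := herm_equiv (V₁ᴴ * (V₂ * V₂ᴴ) * V₁) (W₁ᴴ * (W₂ * W₂ᴴ) * W₁) (hh _ _) (hh _ _)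
    (fun j h1 h2 => by rw [pow_trace _ _ j h1, pow_trace _ _ j h1, h j h1 h2])
  obtain ⟨Y, hY, eY⟩ := gram_aux (X * (V₁ᴴ * V₂))ᴴ (W₁ᴴ * W₂)ᴴ (by
    simp only [conjTranspose_mul, conjTranspose_conjTranspose]
    simp only [Matrix.mul_assoc] at eX ⊢
    exact eX)
  have hX1 : X * Xᴴ = 1 := mem_unitaryGroup_iff.1 hX
  have hX2 : Xᴴ * X = 1 := mem_unitaryGroup_iff'.1 hX
  have hY1 : Y * Yᴴ = 1 := mem_unitaryGroup_iff.1 hY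
  have hY2 : Yᴴ * Y = 1 := mem_unitaryGroup_iff'.1 hY
  have eY1 : Y * (V₂ᴴ * V₁ * Xᴴ) = W₂ᴴ * W₁ := by
    simpa [conjTranspose_mul, Matrix.mul_assoc] using eY
  have eY2 : X * (V₁ᴴ * V₂) * Yᴴ = W₁ᴴ * W₂ := by
    have := congrArg conjTranspose eY1
    simpa [conjTranspose_mul, Matrix.mul_assoc] using this
  obtain ⟨U, hU, eU⟩ := gram_aux (fromCols (V₁ * Xᴴ) (V₂ * Yᴴ)) (fromCols W₁ W₂) (by
    rw [conjTranspose_fromCols_eq_fromRows_conjTranspose,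
      conjTranspose_fromCols_eq_fromRows_conjTranspose, fromRows_mul_fromCols,
      fromRows_mul_fromCols]
    simp only [conjTranspose_mul, conjTranspose_conjTranspose]
    congr 1
    · rw [hW₁, ← hX1]
      calc _ = X * (V₁ᴴ * V₁) * Xᴴ := by simp only [Matrix.mul_assoc]
        _ = _ := by rw [hV₁, Matrix.mul_one]
    · rw [← eY2]; simp only [Matrix.mul_assoc]
    · rw [← eY1]; simp only [Matrix.mul_assoc]
    · rw [hW₂, ← hY1]
      calc _ = Y * (V₂ᴴ * V₂) * Yᴴ := by simp only [Matrix.mul_assoc]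
        _ = _ := by rw [hV₂, Matrix.mul_one])
  rw [mul_fromCols] at eU
  obtain ⟨e1, e2⟩ := (fromCols_inj eU)
  have hU2 : Uᴴ * U = 1 := mem_unitaryGroup_iff'.1 hU
  refine ⟨U, hU, ?_, ?_⟩
  · rw [← e1]
    simp only [conjTranspose_mul, conjTranspose_conjTranspose]
    calc _ = U * V₁ * (Xᴴ * X) * V₁ᴴ * (Uᴴ * U) := by
          rw [hX2, hU2]; simp only [Matrix.mul_assoc, Matrix.mul_one]
      _ = _ := by simp only [Matrix.mul_assoc]
  · rw [← e2]
    simp only [conjTranspose_mul, conjTranspose_conjTranspose]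
    calc _ = U * V₂ * (Yᴴ * Y) * V₂ᴴ * (Uᴴ * U) := by
          rw [hY2, hU2]; simp only [Matrix.mul_assoc, Matrix.mul_one]
      _ = _ := by simp only [Matrix.mul_assoc]

lemma trace_of_intertwine {k : ℕ} (U P Q : Matrix (Fin k) (Fin k) ℂ)
    (hU : Uᴴ * U = 1) (h : U * P = Q * U) : P.trace = Q.trace := by
  have hU' : U * Uᴴ = 1 := mul_eq_one_comm.1 hU
  calc P.trace = (Uᴴ * (U * P)).trace := by rw [← mul_assoc, hU, one_mul]
    _ = (Q * (U * Uᴴ)).trace := by rw [h, trace_mul_comm, mul_assoc]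
    _ = _ := by rw [hU', mul_one]

/-- Two pairs of projections are unitarily equivalent iff the traces of
p₁, p₂ and of the powers (p₁p₂)ʲ for 1 ≤ j ≤ k-1 agree. -/
theorem stmt_2 {k : ℕ} (p₁ p₂ q₁ q₂ : Matrix (Fin k) (Fin k) ℂ)
    (hp₁ : p₁.IsHermitian) (hp₁' : p₁ * p₁ = p₁)
    (hp₂ : p₂.IsHermitian) (hp₂' : p₂ * p₂ = p₂)
    (hq₁ : q₁.IsHermitian) (hq₁' : q₁ * q₁ = q₁)
    (hq₂ : q₂.IsHermitian) (hq₂' : q₂ * q₂ = q₂) :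
    (∃ U ∈ Matrix.unitaryGroup (Fin k) ℂ, U * p₁ = q₁ * U ∧ U * p₂ = q₂ * U) ↔
      (p₁.trace = q₁.trace ∧ p₂.trace = q₂.trace ∧
        ∀ j : ℕ, 1 ≤ j → j ≤ k - 1 →
          ((p₁ * p₂) ^ j).trace = ((q₁ * q₂) ^ j).trace) := by
  constructor
  · rintro ⟨U, hU, h1, h2⟩
    have hU2 : Uᴴ * U = 1 := mem_unitaryGroup_iff'.1 hU
    refine ⟨trace_of_intertwine U _ _ hU2 h1, trace_of_intertwine U _ _ hU2 h2, ?_⟩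
    intro j _ _
    apply trace_of_intertwine U _ _ hU2
    have h12 : SemiconjBy U (p₁ * p₂) (q₁ * q₂) :=
      SemiconjBy.mul_right (show SemiconjBy U p₁ q₁ from h1) (show SemiconjBy U p₂ q₂ from h2)
    exact h12.pow_right j
  · rintro ⟨t1, t2, t⟩
    obtain ⟨a, V₁, hV₁, rfl⟩ := proj_decomp p₁ hp₁ hp₁'
    obtain ⟨b, V₂, hV₂, rfl⟩ := proj_decomp p₂ hp₂ hp₂'
    obtain ⟨a', W₁, hW₁, rfl⟩ := proj_decomp q₁ hq₁ hq₁'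
    obtain ⟨b', W₂, hW₂, rfl⟩ := proj_decomp q₂ hq₂ hq₂'
    have ha : a = a' := by
      rw [col_trace _ hV₁, col_trace _ hW₁] at t1
      exact_mod_cast t1
    have hb : b = b' := by
      rw [col_trace _ hV₂, col_trace _ hW₂] at t2
      exact_mod_cast t2
    subst ha
    subst hb
    apply main_aux V₁ W₁ V₂ W₂ hV₁ hV₂ hW₁ hW₂
    intro j h1 h2
    by_cases hj : j ≤ k - 1
    · exact t j h1 hj
    have hak : a ≤ k := by
      have := rank_mul_le_right V₁ᴴ V₁
      rw [hV₁, rank_one, Fintype.card_fin] at this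
      simpa using this.trans (rank_le_card_height V₁)
    have hak' : a = k := by omega
    subst hak'
    rw [mul_eq_one_comm.1 hV₁, mul_eq_one_comm.1 hW₁, one_mul, one_mul]
    rw [(show IsIdempotentElem (V₂ * V₂ᴴ) from hp₂').pow_eq (by omega),
      (show IsIdempotentElem (W₂ * W₂ᴴ) from hq₂').pow_eq (by omega)]
    exact t2
end

section
/- Let r₁, r₂, s₁, s₂ be k×k self-adjoint involutions (rᵢ* = rᵢ, rᵢ² = I, and similarly for sᵢ). If det(z₀I + z₁r₁ + z₂r₂) = det(z₀I + z₁s₁ + z₂s₂) for all (z₀, z₁, z₂) ∈ ℂ³, then the pairs (r₁, r₂) and (s₁, s₂) are unitarily equivalent. -/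
set_option linter.unusedSimpArgs false

open Matrix in
theorem aux_isospectral {k : ℕ} {A B : Matrix (Fin k) (Fin k) ℂ} (hA : A.IsHermitian)
    (hB : B.IsHermitian) (h : A.charpoly = B.charpoly) :
    ∃ W ∈ Matrix.unitaryGroup (Fin k) ℂ, W * A = B * W := by
  have he : hA.eigenvalues = hB.eigenvalues := (hA.eigenvalues_eq_eigenvalues_iff hB).2 h
  have h1 := hA.spectral_theorem
  have h2 := hB.spectral_theorem
  rw [Unitary.conjStarAlgAut_apply] at h1 h2
  rw [← he] at h2
  set U := hA.eigenvectorUnitary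
  set V := hB.eigenvectorUnitary
  refine ⟨(V * star U : Matrix.unitaryGroup (Fin k) ℂ), (V * star U).2, ?_⟩
  have hU : star (U : Matrix (Fin k) (Fin k) ℂ) * U = 1 := Unitary.coe_star_mul_self U
  have hV : star (V : Matrix (Fin k) (Fin k) ℂ) * V = 1 := Unitary.coe_star_mul_self V
  rw [h1, h2]
  push_cast
  simp only [mul_assoc]
  rw [← mul_assoc (star (U : Matrix (Fin k) (Fin k) ℂ)) U, hU,
    ← mul_assoc (star (V : Matrix (Fin k) (Fin k) ℂ)) V, hV]
  simp

theorem aux_trace_pow {k : ℕ} {A : Matrix (Fin k) (Fin k) ℂ} (hA : A.IsHermitian) (n : ℕ) :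
    (A ^ n).trace = ∑ i, (hA.eigenvalues i : ℂ) ^ n := by
  have h1 := hA.spectral_theorem
  conv_lhs => rw [h1]
  rw [← map_pow, Unitary.conjStarAlgAut_apply, Matrix.trace_mul_comm, ← mul_assoc,
    Unitary.coe_star_mul_self, one_mul, Matrix.diagonal_pow, Matrix.trace_diagonal]
  simp

theorem aux_charpoly_of_trace {k : ℕ} {A B : Matrix (Fin k) (Fin k) ℂ} (hA : A.IsHermitian)
    (hB : B.IsHermitian) (h : ∀ n : ℕ, (A ^ n).trace = (B ^ n).trace) :
    A.charpoly = B.charpoly := by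
  classical
  have hp : ∀ p : Polynomial ℂ, ∑ i, p.eval (hA.eigenvalues i : ℂ)
      = ∑ i, p.eval (hB.eigenvalues i : ℂ) := by
    intro p
    simp only [Polynomial.eval_eq_sum_range]
    rw [Finset.sum_comm, Finset.sum_comm (s := Finset.univ)]
    refine Finset.sum_congr rfl fun n _ => ?_
    rw [← Finset.mul_sum, ← Finset.mul_sum, ← aux_trace_pow, ← aux_trace_pow, h]
  rw [hA.charpoly_eq, hB.charpoly_eq]
  have hm : (Finset.univ.val.map fun i => (hA.eigenvalues i : ℂ))
      = (Finset.univ.val.map fun i => (hB.eigenvalues i : ℂ)) := by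
    ext x
    let s : Finset ℂ := insert x ((Finset.univ.image fun i => (hA.eigenvalues i : ℂ)) ∪
      (Finset.univ.image fun i => (hB.eigenvalues i : ℂ)))
    let p := Lagrange.interpolate s id (fun y => if x = y then (1:ℂ) else 0)
    have hev : ∀ y ∈ s, p.eval y = if x = y then (1:ℂ) else 0 := fun y hy =>
      Lagrange.eval_interpolate_at_node (v := id) _ (Function.injective_id.injOn) hy
    have := hp p
    rw [Finset.sum_congr rfl fun i _ => hev _ (by simp [s]),
      Finset.sum_congr rfl fun i _ => hev (hB.eigenvalues i) (by simp [s])] at this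
    simp only [Finset.sum_boole] at this
    rw [Multiset.count_map, Multiset.count_map]
    exact_mod_cast this
  have := congrArg (fun m : Multiset ℂ => (m.map fun a => Polynomial.X - Polynomial.C a).prod) hm
  simp only [Multiset.map_map] at this
  exact this

open scoped ComplexOrder in
theorem aux_S {k : ℕ} {r d q : Matrix (Fin k) (Fin k) ℂ} (hr : r.IsHermitian)
    (hd : d.IsHermitian) (hq : q.IsHermitian) (hrr : r * r = 1) (hrd : r * d = -(d * r))
    (hrq : r * q = -(q * r)) (hqq : q * q = d * d) :
    ∃ S ∈ Matrix.unitaryGroup (Fin k) ℂ, S * r = r * S ∧ S * d = q * S ∧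
      ∀ x, Commute r x → Commute d x → Commute q x → Commute S x := by
  have he : IsSelfAdjoint (d * d) := by
    rw [isSelfAdjoint_iff, star_mul]
    exact congrArg₂ (· * ·) hd hd
  obtain ⟨f, hf, hfc, hfe⟩ : ∃ f : Matrix (Fin k) (Fin k) ℂ, star f = f ∧
      (∀ x, Commute (d * d) x → Commute f x) ∧ d * d * f * (d * d) = d * d := by
    have hcont : ContinuousOn (fun x : ℝ => x⁻¹) (spectrum ℝ (d * d)) :=
      (Matrix.finite_real_spectrum).continuousOn _
    refine ⟨cfc (fun x : ℝ => x⁻¹) (d * d), cfc_predicate (p := IsSelfAdjoint) _ _, fun x hx => hx.cfc_real _, ?_⟩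
    have hid : cfc (fun x : ℝ => x) (d * d) = d * d := cfc_id' ℝ (d * d) he
    calc d * d * cfc (fun x : ℝ => x⁻¹) (d * d) * (d * d)
        = cfc (fun x : ℝ => x) (d * d) * cfc (fun x : ℝ => x⁻¹) (d * d)
          * cfc (fun x : ℝ => x) (d * d) := by rw [hid]
      _ = cfc (fun x : ℝ => x * x⁻¹ * x) (d * d) := by
          rw [cfc_mul (fun x : ℝ => x * x⁻¹) (fun x => x) (d * d)
              ((Matrix.finite_real_spectrum).continuousOn _) continuousOn_id,
            cfc_mul (fun x : ℝ => x) (fun x => x⁻¹) (d * d) continuousOn_id hcont]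
      _ = d * d := by simp only [mul_inv_cancel_left₀, mul_inv_mul_cancel]; exact hid
  have hfd : d * f = f * d := (hfc d (by simp [Commute, SemiconjBy, mul_assoc])).symm
  have hdq : d * d * q = q * (d * d) := by rw [← hqq, mul_assoc]
  have hfq : q * f = f * q := (hfc q hdq).symm
  have hfr : r * f = f * r := (hfc r (by
    simp only [Commute, SemiconjBy]
    rw [← mul_assoc r, hrd, neg_mul, mul_assoc d r, hrd, mul_neg, neg_neg, mul_assoc])).symm
  have hgz : ∀ x : Matrix (Fin k) (Fin k) ℂ, x.IsHermitian → x * x = d * d → x * f = f * x →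
      f * (x * (d * d)) = x := by
    intro x hx hxx hxf
    have hfe' : f * (x * (x * (x * x))) = x * x := by
      rw [← hxx] at hfe
      refine Eq.trans ?_ hfe
      rw [mul_assoc x x f, hxf, ← mul_assoc x f, hxf]
      simp only [mul_assoc]
    have hfe2 (y) : f * (x * (x * (x * (x * y)))) = x * (x * y) := by
      have := congrArg (· * y) hfe'
      simpa only [mul_assoc] using this
    have hxf' (y) : x * (f * y) = f * (x * y) := by
      rw [← mul_assoc, hxf, mul_assoc]
    have hx' : star x = x := hx
    rw [← hxx]
    have : Matrix.conjTranspose (x - f * (x * (x * x))) * (x - f * (x * (x * x))) = 0 := by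
      rw [← Matrix.star_eq_conjTranspose]
      simp only [star_sub, star_mul, hf, hx', mul_sub, sub_mul, mul_assoc, hxf, hxf', hfe', hfe2]
      abel
    exact (sub_eq_zero.1 (Matrix.conjTranspose_mul_self_eq_zero.1 this)).symm
  have h1 : f * (d * (d * d)) = d := hgz d hd rfl hfd
  have h2 : f * (q * (d * d)) = q := hgz q hq hqq hfq
  have hr' : star r = r := hr
  have hd' : star d = d := hd
  have hq' : star q = q := hq
  have m {a b c e : Matrix (Fin k) (Fin k) ℂ} (h : a * b = c * e) (x) : a * (b * x) = c * (e * x) := by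
    rw [← mul_assoc, h, mul_assoc]
  have mneg {a b c e : Matrix (Fin k) (Fin k) ℂ} (h : a * b = -(c * e)) (x) : a * (b * x) = -(c * (e * x)) := by
    rw [← mul_assoc, h, neg_mul, mul_assoc]
  have m1 (x) : r * (r * x) = x := by rw [← mul_assoc, hrr, one_mul]
  have h1' (x) : f * (d * (d * (d * x))) = d * x := by
    conv_rhs => rw [← h1]
    simp only [mul_assoc]
  have h2' (x) : f * (q * (d * (d * x))) = q * x := by
    conv_rhs => rw [← h2]
    simp only [mul_assoc]
  have hdq1 : d * (d * q) = q * (d * d) := by rw [← mul_assoc, hdq]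
  have hdq2 (x) : d * (d * (q * x)) = q * (d * (d * x)) := by
    rw [← mul_assoc, ← mul_assoc, hdq]; simp only [mul_assoc]
  refine ⟨(2⁻¹ : ℂ) • (1 + r + (f * (q * d) + 1 - f * (d * d)) * (1 - r)), ?_, ?_, ?_, ?_⟩
  · rw [Matrix.mem_unitaryGroup_iff']
    simp only [star_smul, star_add, star_sub, star_mul, star_one, hf, hr', hd', hq', mul_add, add_mul, mul_sub, sub_mul,
      mul_assoc, mul_one, one_mul, mul_neg, neg_mul, neg_neg, hfd, hfq, hfr, hrr, hrd, hrq, hqq, m hfd, m hfq, m hfr,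
      m1, mneg hrd, mneg hrq, m hqq, h1, h2, h1', h2', hdq1, hdq2, smul_mul_assoc, mul_smul_comm]
    simp only [star_inv₀, star_ofNat]
    module
  · simp only [mul_add, add_mul, mul_sub, sub_mul,
      mul_assoc, mul_one, one_mul, mul_neg, neg_mul, neg_neg, hfd, hfq, hfr, hrr, hrd, hrq, hqq, m hfd, m hfq, m hfr,
      m1, mneg hrd, mneg hrq, m hqq, h1, h2, h1', h2', hdq1, hdq2, smul_mul_assoc, mul_smul_comm]
  · simp only [mul_add, add_mul, mul_sub, sub_mul,
      mul_assoc, mul_one, one_mul, mul_neg, neg_mul, neg_neg, hfd, hfq, hfr, hrr, hrd, hrq, hqq, m hfd, m hfq, m hfr,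
      m1, mneg hrd, mneg hrq, m hqq, h1, h2, h1', h2', hdq1, hdq2, smul_mul_assoc, mul_smul_comm]
    congr 1
    abel
  · intro x hx1 hx2 hx3
    have hdx := hx2.mul_left hx2
    have hfx := hfc x hdx
    have h1x := Commute.one_left x
    exact Commute.smul_left ((h1x.add_left hx1).add_left ((((hfx.mul_left (hx3.mul_left hx2)).add_left
      h1x).sub_left (hfx.mul_left hdx)).mul_left (h1x.sub_left hx1))) _

open scoped ComplexOrder in
theorem aux_posDef {k : ℕ} {r₁ r₂ : Matrix (Fin k) (Fin k) ℂ}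
    (hr₁ : r₁.IsHermitian) (hr₁' : r₁ * r₁ = 1)
    (hr₂ : r₂.IsHermitian) (hr₂' : r₂ * r₂ = 1) :
    ((3 : ℂ) • (1 : Matrix (Fin k) (Fin k) ℂ) + r₂ + r₁ * (r₂ * r₁)).PosDef := by
  have h1 (x) : r₁ * (r₁ * x) = x := by rw [← mul_assoc, hr₁', one_mul]
  have h2 (x) : r₂ * (r₂ * x) = x := by rw [← mul_assoc, hr₂', one_mul]
  have e1 : star r₁ = r₁ := hr₁
  have e2 : star r₂ = r₂ := hr₂
  have key : (3 : ℂ) • (1 : Matrix (Fin k) (Fin k) ℂ) + r₂ + r₁ * (r₂ * r₁) = 1 +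
      (star ((2⁻¹ : ℂ) • ((r₁ + r₂) * (1 + r₁))) * ((2⁻¹ : ℂ) • ((r₁ + r₂) * (1 + r₁))) +
      star ((2⁻¹ : ℂ) • ((r₁ - r₂) * (1 - r₁))) * ((2⁻¹ : ℂ) • ((r₁ - r₂) * (1 - r₁)))) := by
    simp only [star_smul, star_mul, star_add, star_sub, star_one, e1, e2, mul_add, add_mul,
      mul_sub, sub_mul, mul_assoc, hr₁', hr₂', h1, h2, mul_one, one_mul, smul_mul_assoc,
      mul_smul_comm, star_inv₀, star_ofNat]
    module
  rw [key]
  exact Matrix.PosDef.one.add_posSemidef ((Matrix.posSemidef_conjTranspose_mul_self _).add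
    (Matrix.posSemidef_conjTranspose_mul_self _))

open scoped ComplexOrder MatrixOrder Matrix.Norms.L2Operator in
theorem aux_sqrt {k : ℕ} {A B : Matrix (Fin k) (Fin k) ℂ} (hA : A.PosDef) (hB : B.PosDef)
    (h : A * A = B * B) : A = B := by
  have h1 := CFC.sqrt_unique h (Matrix.nonneg_iff_posSemidef.2 hA.posSemidef)
  have h2 := CFC.sqrt_unique (rfl : B * B = B * B) (Matrix.nonneg_iff_posSemidef.2 hB.posSemidef)
  exact h1.symm.trans h2

open scoped ComplexOrder in
theorem aux_eq {k : ℕ} {r₁ r₂ s₁ s₂ : Matrix (Fin k) (Fin k) ℂ}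
    (hr₁ : r₁.IsHermitian) (hr₁' : r₁ * r₁ = 1)
    (hr₂ : r₂.IsHermitian) (hr₂' : r₂ * r₂ = 1)
    (hs₁ : s₁.IsHermitian) (hs₁' : s₁ * s₁ = 1)
    (hs₂ : s₂.IsHermitian) (hs₂' : s₂ * s₂ = 1)
    (h : (3 : ℂ) • r₁ + (r₁ * r₂ + r₂ * r₁) = (3 : ℂ) • s₁ + (s₁ * s₂ + s₂ * s₁)) :
    r₁ = s₁ := by
  have hr := aux_posDef hr₁ hr₁' hr₂ hr₂'
  have hs := aux_posDef hs₁ hs₁' hs₂ hs₂'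
  have hm : ∀ r₁ r₂ : Matrix (Fin k) (Fin k) ℂ, r₁ * r₁ = 1 →
      ((3 : ℂ) • (1 : Matrix (Fin k) (Fin k) ℂ) + r₂ + r₁ * (r₂ * r₁)) * r₁ =
      (3 : ℂ) • r₁ + (r₁ * r₂ + r₂ * r₁) := by
    intro r₁ r₂ h
    simp only [add_mul, mul_assoc, h, mul_one, smul_mul_assoc, one_mul]
    abel
  have hm2 : ∀ r₁ r₂ : Matrix (Fin k) (Fin k) ℂ, r₁ * r₁ = 1 →
      ((3 : ℂ) • (1 : Matrix (Fin k) (Fin k) ℂ) + r₂ + r₁ * (r₂ * r₁)) *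
      ((3 : ℂ) • (1 : Matrix (Fin k) (Fin k) ℂ) + r₂ + r₁ * (r₂ * r₁)) =
      ((3 : ℂ) • r₁ + (r₁ * r₂ + r₂ * r₁)) * ((3 : ℂ) • r₁ + (r₁ * r₂ + r₂ * r₁)) := by
    intro r₁ r₂ h
    have h1 (x) : r₁ * (r₁ * x) = x := by rw [← mul_assoc, h, one_mul]
    simp only [add_mul, mul_add, mul_assoc, h, h1, mul_one, smul_mul_assoc, one_mul, mul_smul_comm]
    module
  have hMM := aux_sqrt hr hs (by rw [hm2 _ _ hr₁', hm2 _ _ hs₁', h])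
  have := hm r₁ r₂ hr₁'
  rw [h, ← hm s₁ s₂ hs₁', hMM] at this
  exact hs.isUnit.mul_left_cancel this

open scoped ComplexOrder in
theorem aux_conj {k : ℕ} {r₁ r₂ s₂ : Matrix (Fin k) (Fin k) ℂ}
    (hr₁ : r₁.IsHermitian) (hr₁' : r₁ * r₁ = 1)
    (hr₂ : r₂.IsHermitian) (hr₂' : r₂ * r₂ = 1)
    (hs₂ : s₂.IsHermitian) (hs₂' : s₂ * s₂ = 1)
    (h : r₁ * r₂ + r₂ * r₁ = r₁ * s₂ + s₂ * r₁) :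
    ∃ S ∈ Matrix.unitaryGroup (Fin k) ℂ, S * r₁ = r₁ * S ∧ S * r₂ = s₂ * S := by
  have h1 (x) : r₁ * (r₁ * x) = x := by rw [← mul_assoc, hr₁', one_mul]
  have h2 (x) : r₂ * (r₂ * x) = x := by rw [← mul_assoc, hr₂', one_mul]
  have h3 (x) : s₂ * (s₂ * x) = x := by rw [← mul_assoc, hs₂', one_mul]
  have e1 : star r₁ = r₁ := hr₁
  have e2 : star r₂ = r₂ := hr₂
  have e3 : star s₂ = s₂ := hs₂
  have hc := congrArg (fun x => x * x) h
  simp only [add_mul, mul_add, mul_assoc, h1, h2, h3, hr₁', hr₂', hs₂'] at hc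
  have hc2 := congrArg (fun x => r₁ * x) h
  simp only [mul_add, h1] at hc2
  obtain ⟨S, hS, hS1, hS2, hS3⟩ := aux_S (r := r₁) (d := (2⁻¹ : ℂ) • (r₂ - r₁ * (r₂ * r₁)))
    (q := (2⁻¹ : ℂ) • (s₂ - r₁ * (s₂ * r₁))) hr₁
    (by
      change star _ = _
      simp only [star_smul, star_sub, star_mul, e1, e2, mul_assoc, star_inv₀, star_ofNat])
    (by
      change star _ = _
      simp only [star_smul, star_sub, star_mul, e1, e3, mul_assoc, star_inv₀, star_ofNat])
    hr₁'
    (by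
      simp only [mul_sub, sub_mul, mul_smul_comm, smul_mul_assoc, mul_assoc, h1, hr₁', mul_one]
      module)
    (by
      simp only [mul_sub, sub_mul, mul_smul_comm, smul_mul_assoc, mul_assoc, h1, hr₁', mul_one]
      module)
    (by
      simp only [mul_sub, sub_mul, mul_smul_comm, smul_mul_assoc, mul_assoc, h1, h2, h3, hr₁',
        hr₂', hs₂', mul_one]
      linear_combination (norm := module) (1/4 : ℂ) • hc)
  refine ⟨S, hS, hS1, ?_⟩
  have a1 : r₂ = (2⁻¹ : ℂ) • (r₂ + r₁ * (r₂ * r₁)) + (2⁻¹ : ℂ) • (r₂ - r₁ * (r₂ * r₁)) := by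
    module
  have a2 : s₂ = (2⁻¹ : ℂ) • (r₂ + r₁ * (r₂ * r₁)) + (2⁻¹ : ℂ) • (s₂ - r₁ * (s₂ * r₁)) := by
    rw [hc2]
    module
  have hcomm : ∀ t : Matrix (Fin k) (Fin k) ℂ, t * t = 1 →
      Commute r₁ (r₁ * t + t * r₁) ∧
      Commute ((2⁻¹ : ℂ) • (t - r₁ * (t * r₁))) (r₁ * t + t * r₁) := by
    intro t ht
    have h4 (x) : t * (t * x) = x := by rw [← mul_assoc, ht, one_mul]
    constructor
    · simp only [Commute, SemiconjBy, mul_add, add_mul, mul_smul_comm, smul_mul_assoc, mul_assoc,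
        h1, hr₁', mul_one]
      module
    · simp only [Commute, SemiconjBy, mul_add, add_mul, mul_sub, sub_mul, mul_smul_comm,
        smul_mul_assoc, mul_assoc, h1, hr₁', h4, ht, mul_one]
      module
  have hST := hS3 _ (hcomm r₂ hr₂').1 (hcomm r₂ hr₂').2 (by
    rw [h]; exact (hcomm s₂ hs₂').2)
  have hST1 : Commute S r₁ := hS1
  have hST2 : Commute S ((2⁻¹ : ℂ) • (r₂ + r₁ * (r₂ * r₁))) := by
    have h5 : r₂ + r₁ * (r₂ * r₁) = r₁ * (r₁ * r₂ + r₂ * r₁) := by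
      rw [mul_add, h1]
    rw [h5]
    exact (hST1.mul_right hST).smul_right _
  calc S * r₂ = S * ((2⁻¹ : ℂ) • (r₂ + r₁ * (r₂ * r₁)))
          + S * ((2⁻¹ : ℂ) • (r₂ - r₁ * (r₂ * r₁))) := by
        rw [← mul_add, ← a1]
    _ = s₂ * S := by
        rw [hST2.eq, hS2, ← add_mul, ← a2]

theorem aux_charpoly_ext {k : ℕ} {A B : Matrix (Fin k) (Fin k) ℂ}
    (h : ∀ x : ℂ, (x • (1 : Matrix (Fin k) (Fin k) ℂ) - A).det =
      (x • (1 : Matrix (Fin k) (Fin k) ℂ) - B).det) : A.charpoly = B.charpoly := by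
  refine Polynomial.funext fun x => ?_
  rw [Matrix.eval_charpoly, Matrix.eval_charpoly]
  have : Matrix.scalar (Fin k) x = x • (1 : Matrix (Fin k) (Fin k) ℂ) := by
    rw [Matrix.smul_one_eq_diagonal]; rfl
  rw [this, h]

theorem aux_charpoly_H {k : ℕ} {r₁ r₂ s₁ s₂ c c' : Matrix (Fin k) (Fin k) ℂ}
    (hr₁ : r₁.IsHermitian) (hr₁' : r₁ * r₁ = 1)
    (hr₂ : r₂.IsHermitian) (hr₂' : r₂ * r₂ = 1)
    (hs₁ : s₁.IsHermitian) (hs₁' : s₁ * s₁ = 1)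
    (hs₂ : s₂.IsHermitian) (hs₂' : s₂ * s₂ = 1)
    (hc : c = r₁ * r₂ + r₂ * r₁) (hc' : c' = s₁ * s₂ + s₂ * s₁)
    (h : ∀ z₀ z₁ z₂ : ℂ,
      (z₀ • (1 : Matrix (Fin k) (Fin k) ℂ) + z₁ • r₁ + z₂ • r₂).det =
        (z₀ • (1 : Matrix (Fin k) (Fin k) ℂ) + z₁ • s₁ + z₂ • s₂).det) :
    ∀ n, (((3 : ℂ) • r₁ + c) ^ n).trace = (((3 : ℂ) • s₁ + c') ^ n).trace := by
  have hct : c.IsHermitian := by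
    rw [hc]
    change star _ = _
    rw [star_add, star_mul, star_mul, show star r₁ = r₁ from hr₁, show star r₂ = r₂ from hr₂,
      add_comm]
  have hct' : c'.IsHermitian := by
    rw [hc']
    change star _ = _
    rw [star_add, star_mul, star_mul, show star s₁ = s₁ from hs₁, show star s₂ = s₂ from hs₂,
      add_comm]
  have t1 : r₁.trace = s₁.trace := by
    rw [Matrix.trace_eq_neg_charpoly_nextCoeff, Matrix.trace_eq_neg_charpoly_nextCoeff,
      aux_charpoly_ext fun x => by simpa [sub_eq_add_neg] using h x (-1) 0]
  have t2 : r₂.trace = s₂.trace := by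
    rw [Matrix.trace_eq_neg_charpoly_nextCoeff, Matrix.trace_eq_neg_charpoly_nextCoeff,
      aux_charpoly_ext fun x => by simpa [sub_eq_add_neg] using h x 0 (-1)]
  have hdet : ∀ (r₁ r₂ : Matrix (Fin k) (Fin k) ℂ) (z : ℂ), r₁ * r₁ = 1 → r₂ * r₂ = 1 →
      (z • (1 : Matrix (Fin k) (Fin k) ℂ) + (1 : ℂ) • r₁ + (1 : ℂ) • r₂).det *
      (z • (1 : Matrix (Fin k) (Fin k) ℂ) + (-1 : ℂ) • r₁ + (-1 : ℂ) • r₂).det =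
      ((z ^ 2 - 2) • (1 : Matrix (Fin k) (Fin k) ℂ) - (r₁ * r₂ + r₂ * r₁)).det := by
    intro r₁ r₂ z h1 h2
    rw [← Matrix.det_mul]
    congr 1
    simp only [mul_add, add_mul, smul_mul_assoc, mul_smul_comm, h1, h2, mul_one, one_mul]
    module
  have hcp : c.charpoly = c'.charpoly := by
    refine aux_charpoly_ext fun x => ?_
    obtain ⟨z, hz⟩ := IsAlgClosed.exists_pow_nat_eq (x + 2) (n := 2) (by norm_num)
    have hx : x = z ^ 2 - 2 := by rw [hz]; ring
    rw [hx, hc, hc', ← hdet _ _ _ hr₁' hr₂', ← hdet _ _ _ hs₁' hs₂', h, h]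
  have tc : ∀ n, (c ^ n).trace = (c' ^ n).trace := by
    intro n
    have he : hct.eigenvalues = hct'.eigenvalues := (hct.eigenvalues_eq_eigenvalues_iff hct').2 hcp
    rw [aux_trace_pow hct, aux_trace_pow hct', he]
  have hrec : ∀ (r₁ r₂ : Matrix (Fin k) (Fin k) ℂ) (n : ℕ), r₁ * r₁ = 1 → r₂ * r₂ = 1 →
      ((r₁ * r₂ + r₂ * r₁) ^ (n + 1) * r₁).trace =
        2 * ((r₁ * r₂ + r₂ * r₁) ^ n * r₂).trace := by
    intro r₁ r₂ n h1 h2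
    have hcm : Commute (r₁ * r₂ + r₂ * r₁) r₁ := by
      simp only [Commute, SemiconjBy, add_mul, mul_add, mul_assoc, h1]
      simp only [← mul_assoc, h1, one_mul, mul_one, add_comm]
    have hcn := hcm.pow_left n
    have e1 : (r₁ * r₂ + r₂ * r₁) ^ (n + 1) * r₁ =
        r₁ * (((r₁ * r₂ + r₂ * r₁) ^ n * r₂) * r₁) + (r₁ * r₂ + r₂ * r₁) ^ n * r₂ := by
      rw [← mul_assoc, ← mul_assoc, ← hcn.eq, pow_succ]
      simp only [mul_assoc, add_mul, mul_add, h1, mul_one]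
    rw [e1, Matrix.trace_add, Matrix.trace_mul_comm r₁, mul_assoc _ r₁ r₁, h1, mul_one, two_mul]
  have trc : ∀ n, (c ^ n * r₁).trace = (c' ^ n * s₁).trace ∧
      (c ^ n * r₂).trace = (c' ^ n * s₂).trace := by
    intro n
    induction n with
    | zero => simpa using ⟨t1, t2⟩
    | succ n ih =>
      constructor
      · rw [hc, hc', hrec _ _ _ hr₁' hr₂', hrec _ _ _ hs₁' hs₂', ← hc, ← hc', ih.2]
      · have a := hrec r₂ r₁ n hr₂' hr₁'
        have b := hrec s₂ s₁ n hs₂' hs₁'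
        rw [add_comm, ← hc] at a
        rw [add_comm, ← hc'] at b
        rw [a, b, ih.1]
  have hcm : ∀ (r₁ r₂ : Matrix (Fin k) (Fin k) ℂ), r₁ * r₁ = 1 →
      Commute r₁ (r₁ * r₂ + r₂ * r₁) := by
    intro r₁ r₂ h1
    simp only [Commute, SemiconjBy, add_mul, mul_add, mul_assoc, h1]
    simp only [← mul_assoc, h1, one_mul, mul_one, add_comm]
  have hcr := hcm r₁ r₂ hr₁'
  have hcs := hcm s₁ s₂ hs₁'
  rw [← hc] at hcr
  rw [← hc'] at hcs
  have e1 : ∀ (r c : Matrix (Fin k) (Fin k) ℂ) (n a : ℕ), Commute r c →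
      (((3 : ℂ) • r + c) ^ (n + 1) * c ^ a).trace =
      3 * (((3 : ℂ) • r + c) ^ n * (c ^ a * r)).trace +
        (((3 : ℂ) • r + c) ^ n * c ^ (a + 1)).trace := by
    intro r c n a hrc
    rw [pow_succ, mul_assoc, add_mul, smul_mul_assoc, (hrc.pow_right a).eq, ← pow_succ' c, mul_add,
      Matrix.trace_add, mul_smul_comm, Matrix.trace_smul, smul_eq_mul]
  have e2 : ∀ (r c : Matrix (Fin k) (Fin k) ℂ) (n a : ℕ), Commute r c → r * r = 1 →
      (((3 : ℂ) • r + c) ^ (n + 1) * (c ^ a * r)).trace =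
      3 * (((3 : ℂ) • r + c) ^ n * c ^ a).trace +
        (((3 : ℂ) • r + c) ^ n * (c ^ (a + 1) * r)).trace := by
    intro r c n a hrc hr
    rw [pow_succ, mul_assoc, add_mul, smul_mul_assoc, ← mul_assoc r, (hrc.pow_right a).eq,
      mul_assoc _ r r, hr, mul_one, ← mul_assoc c, ← pow_succ' c, mul_add,
      Matrix.trace_add, mul_smul_comm, Matrix.trace_smul, smul_eq_mul]
  have main : ∀ n a, (((3 : ℂ) • r₁ + c) ^ n * c ^ a).trace =
        (((3 : ℂ) • s₁ + c') ^ n * c' ^ a).trace ∧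
      (((3 : ℂ) • r₁ + c) ^ n * (c ^ a * r₁)).trace =
        (((3 : ℂ) • s₁ + c') ^ n * (c' ^ a * s₁)).trace := by
    intro n
    induction n with
    | zero => intro a; simpa using ⟨tc a, (trc a).1⟩
    | succ n ih =>
      intro a
      rw [e1 _ _ _ _ hcr, e1 _ _ _ _ hcs, e2 _ _ _ _ hcr hr₁', e2 _ _ _ _ hcs hs₁',
        (ih a).1, (ih a).2, (ih (a + 1)).1, (ih (a + 1)).2]
      exact ⟨rfl, rfl⟩
  intro n
  simpa using (main n 0).1

/-- Two pairs of self-adjoint involutions with the same characteristic polynomial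
are unitarily equivalent. -/
theorem stmt_9 {k : ℕ} (r₁ r₂ s₁ s₂ : Matrix (Fin k) (Fin k) ℂ)
    (hr₁ : r₁.IsHermitian) (hr₁' : r₁ * r₁ = 1)
    (hr₂ : r₂.IsHermitian) (hr₂' : r₂ * r₂ = 1)
    (hs₁ : s₁.IsHermitian) (hs₁' : s₁ * s₁ = 1)
    (hs₂ : s₂.IsHermitian) (hs₂' : s₂ * s₂ = 1)
    (h : ∀ z₀ z₁ z₂ : ℂ,
      (z₀ • (1 : Matrix (Fin k) (Fin k) ℂ) + z₁ • r₁ + z₂ • r₂).det =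
        (z₀ • (1 : Matrix (Fin k) (Fin k) ℂ) + z₁ • s₁ + z₂ • s₂).det) :
    ∃ U ∈ Matrix.unitaryGroup (Fin k) ℂ, U * r₁ = s₁ * U ∧ U * r₂ = s₂ * U := by
  have hH : ∀ r₁ r₂ : Matrix (Fin k) (Fin k) ℂ, r₁.IsHermitian → r₂.IsHermitian →
      ((3 : ℂ) • r₁ + (r₁ * r₂ + r₂ * r₁)).IsHermitian := by
    intro r₁ r₂ h1 h2
    change star _ = _
    simp only [star_add, star_mul, star_smul, show star r₁ = r₁ from h1, show star r₂ = r₂ from h2,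
      star_ofNat, add_comm (r₁ * r₂)]
  obtain ⟨W, hW, hWH⟩ := aux_isospectral (hH _ _ hr₁ hr₂) (hH _ _ hs₁ hs₂)
    (aux_charpoly_of_trace (hH _ _ hr₁ hr₂) (hH _ _ hs₁ hs₂)
      (aux_charpoly_H hr₁ hr₁' hr₂ hr₂' hs₁ hs₁' hs₂ hs₂' rfl rfl h))
  have hW1 : star W * W = 1 := Matrix.mem_unitaryGroup_iff'.1 hW
  have hW2 : W * star W = 1 := Matrix.mem_unitaryGroup_iff.1 hW
  have hW1' (x) : star W * (W * x) = x := by rw [← mul_assoc, hW1, one_mul]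
  have herm : ∀ r : Matrix (Fin k) (Fin k) ℂ, r.IsHermitian → (W * (r * star W)).IsHermitian := by
    intro r hr
    change star _ = _
    simp only [star_mul, star_star, show star r = r from hr, mul_assoc]
  have hinv : ∀ r : Matrix (Fin k) (Fin k) ℂ, r * r = 1 →
      (W * (r * star W)) * (W * (r * star W)) = 1 := by
    intro r hr
    simp only [mul_assoc, hW1']
    rw [← mul_assoc r, hr, one_mul, hW2]
  have hEq : (3 : ℂ) • (W * (r₁ * star W)) + ((W * (r₁ * star W)) * (W * (r₂ * star W)) +
      (W * (r₂ * star W)) * (W * (r₁ * star W))) = (3 : ℂ) • s₁ + (s₁ * s₂ + s₂ * s₁) := by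
    have := congrArg (· * star W) hWH
    simp only [mul_assoc _ W, hW2, mul_one] at this
    rw [← this]
    simp only [mul_add, add_mul, mul_assoc, hW1', smul_mul_assoc, mul_smul_comm]
  have hE := aux_eq (herm _ hr₁) (hinv _ hr₁') (herm _ hr₂) (hinv _ hr₂') hs₁ hs₁' hs₂ hs₂' hEq
  rw [hE] at hEq
  obtain ⟨S, hS, hS1, hS2⟩ := aux_conj hs₁ hs₁' (herm _ hr₂) (hinv _ hr₂') hs₂ hs₂'
    (add_left_cancel hEq)
  have hb : ∀ r, W * (r * star W) * W = W * r := by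
    intro r
    rw [mul_assoc, mul_assoc, hW1, mul_one]
  refine ⟨S * W, mul_mem hS hW, ?_, ?_⟩
  · rw [mul_assoc, ← hb, ← mul_assoc, hE, hS1, mul_assoc]
  · rw [mul_assoc, ← hb, ← mul_assoc, hS2, mul_assoc]
end

section
/- Let P and Q be k×k projection matrices, L = range P, N = range Q, and set k₁ = dim(L^⊥ ∩ N^⊥), k₂ = dim(L ∩ N^⊥), k₃ = dim(L^⊥ ∩ N), k₄ = dim(L ∩ N). Then there exist a natural number m with k₁ + k₂ + k₃ + k₄ + 2m = k and real numbers x₁,…,x_m ∈ (0,1) such that for all (z₀, z₁, z₂) ∈ ℂ³: det(z₀I + z₁P + z₂Q) = z₀^{k₁} (z₀+z₁)^{k₂} (z₀+z₂)^{k₃} (z₀+z₁+z₂)^{k₄} · ∏_{i=1}^{m} (z₀² + z₀(z₁+z₂) + x_i z₁ z₂). -/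
/-- Joint eigenspace of `p` (eigenvalue `a`) and `q` (eigenvalue `b`). -/
def jointK {E : Type*} [AddCommGroup E] [Module ℂ E] (p q : E →ₗ[ℂ] E) (a b : ℂ) :
    Submodule ℂ E := LinearMap.ker (p - a • LinearMap.id) ⊓ LinearMap.ker (q - b • LinearMap.id)

theorem mem_jointK {E : Type*} [AddCommGroup E] [Module ℂ E] (p q : E →ₗ[ℂ] E) (a b : ℂ) (x : E) :
    x ∈ jointK p q a b ↔ p x = a • x ∧ q x = b • x := by
  simp [jointK, sub_eq_zero]

/-- The factorization property. -/
def HalmosT {E : Type*} [AddCommGroup E] [Module ℂ E] (p q : E →ₗ[ℂ] E) : Prop :=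
  ∃ (m : ℕ) (x : Fin m → ℝ), (∀ i, x i ∈ Set.Ioo (0 : ℝ) 1) ∧
    Module.finrank ℂ (jointK p q 0 0) + Module.finrank ℂ (jointK p q 1 0)
      + Module.finrank ℂ (jointK p q 0 1) + Module.finrank ℂ (jointK p q 1 1) + 2 * m
      = Module.finrank ℂ E ∧
    ∀ z₀ z₁ z₂ : ℂ, LinearMap.det (z₀ • LinearMap.id + z₁ • p + z₂ • q) =
      z₀ ^ Module.finrank ℂ (jointK p q 0 0) * (z₀ + z₁) ^ Module.finrank ℂ (jointK p q 1 0)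
        * (z₀ + z₂) ^ Module.finrank ℂ (jointK p q 0 1)
        * (z₀ + z₁ + z₂) ^ Module.finrank ℂ (jointK p q 1 1) *
            ∏ i, (z₀ ^ 2 + z₀ * (z₁ + z₂) + (x i : ℂ) * z₁ * z₂)

theorem finrank_jointK_add {E V W : Type*} [AddCommGroup E] [Module ℂ E]
    [AddCommGroup V] [Module ℂ V] [AddCommGroup W] [Module ℂ W]
    [FiniteDimensional ℂ V] [FiniteDimensional ℂ W]
    (e : (V × W) ≃ₗ[ℂ] E) (p q : E →ₗ[ℂ] E) (pV qV : V →ₗ[ℂ] V) (pW qW : W →ₗ[ℂ] W)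
    (hp : ∀ x, p (e x) = e (pV x.1, pW x.2)) (hq : ∀ x, q (e x) = e (qV x.1, qW x.2)) (a b : ℂ) :
    Module.finrank ℂ (jointK p q a b) =
      Module.finrank ℂ (jointK pV qV a b) + Module.finrank ℂ (jointK pW qW a b) := by
  let f : (jointK pV qV a b × jointK pW qW a b) →ₗ[ℂ] E :=
    e.toLinearMap ∘ₗ LinearMap.prodMap (Submodule.subtype _) (Submodule.subtype _)
  have hf : Function.Injective f := by
    apply e.injective.comp
    rintro ⟨x, y⟩ ⟨x', y'⟩ h
    have h1 := congrArg Prod.fst h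
    have h2 := congrArg Prod.snd h
    exact Prod.ext (Subtype.ext h1) (Subtype.ext h2)
  have hr : LinearMap.range f = jointK p q a b := by
    ext x
    obtain ⟨⟨v, w⟩, rfl⟩ := e.surjective x
    rw [mem_jointK, hp, hq, ← map_smul, ← map_smul, e.injective.eq_iff, e.injective.eq_iff]
    simp only [Prod.smul_mk, Prod.mk.injEq]
    constructor
    · rintro ⟨⟨⟨x, hx⟩, ⟨y, hy⟩⟩, h⟩
      have h' := e.injective h
      simp only [LinearMap.prodMap_apply, Submodule.subtype_apply, Prod.mk.injEq] at h'
      obtain ⟨rfl, rfl⟩ := h'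
      rw [mem_jointK] at hx hy
      tauto
    · rintro ⟨⟨h1, h2⟩, h3, h4⟩
      exact ⟨⟨⟨v, (mem_jointK _ _ _ _ _).2 ⟨h1, h3⟩⟩, ⟨w, (mem_jointK _ _ _ _ _).2 ⟨h2, h4⟩⟩⟩, rfl⟩
  rw [← hr, LinearMap.finrank_range_of_inj hf, Module.finrank_prod]

theorem HalmosT.prod {E V W : Type*} [AddCommGroup E] [Module ℂ E]
    [AddCommGroup V] [Module ℂ V] [AddCommGroup W] [Module ℂ W]
    [FiniteDimensional ℂ V] [FiniteDimensional ℂ W]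
    (e : (V × W) ≃ₗ[ℂ] E) (p q : E →ₗ[ℂ] E) (pV qV : V →ₗ[ℂ] V) (pW qW : W →ₗ[ℂ] W)
    (hp : ∀ x, p (e x) = e (pV x.1, pW x.2)) (hq : ∀ x, q (e x) = e (qV x.1, qW x.2))
    (hV : HalmosT pV qV) (hW : HalmosT pW qW) : HalmosT p q := by
  obtain ⟨m, x, hx, hm, hd⟩ := hV
  obtain ⟨n, y, hy, hn, hd'⟩ := hW
  have hk := finrank_jointK_add e p q pV qV pW qW hp hq
  refine ⟨m + n, Fin.append x y, ?_, ?_, ?_⟩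
  · intro i
    refine Fin.addCases (fun i => ?_) (fun i => ?_) i
    · simpa using hx i
    · simpa using hy i
  · rw [← e.finrank_eq, Module.finrank_prod]
    simp only [hk]
    omega
  · intro z₀ z₁ z₂
    have h1 : z₀ • LinearMap.id + z₁ • p + z₂ • q =
        e.toLinearMap ∘ₗ (LinearMap.prodMap (z₀ • LinearMap.id + z₁ • pV + z₂ • qV)
          (z₀ • LinearMap.id + z₁ • pW + z₂ • qW)) ∘ₗ e.symm.toLinearMap := by
      ext u
      obtain ⟨⟨v, w⟩, rfl⟩ := e.surjective u
      simp only [LinearMap.add_apply, LinearMap.smul_apply, hp, hq, LinearMap.id_apply,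
        LinearMap.comp_apply, LinearEquiv.coe_coe, LinearEquiv.symm_apply_apply,
        LinearMap.prodMap_apply, ← map_smul, ← map_add]
      simp
    rw [h1, LinearMap.det_conj, LinearMap.det_prodMap, hd, hd', Fin.prod_univ_add]
    simp only [hk, Fin.append_left, Fin.append_right, pow_add]
    ring

theorem finrank_jointK_smul {E : Type*} [AddCommGroup E] [Module ℂ E]
    (p q : E →ₗ[ℂ] E) (a b : ℂ) (hp : ∀ x, p x = a • x) (hq : ∀ x, q x = b • x) (c d : ℂ) :
    Module.finrank ℂ (jointK p q c d) = if a = c ∧ b = d then Module.finrank ℂ E else 0 := by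
  split_ifs with h
  · obtain ⟨rfl, rfl⟩ := h
    have : jointK p q a b = ⊤ := by
      ext x; simp [mem_jointK, hp, hq]
    rw [this, finrank_top]
  · have : jointK p q c d = ⊥ := by
      rw [eq_bot_iff]
      intro x hx
      rw [mem_jointK, hp, hq, ← sub_eq_zero, ← sub_eq_zero (b := d • x), ← sub_smul, ← sub_smul,
        smul_eq_zero, smul_eq_zero, sub_eq_zero, sub_eq_zero] at hx
      rw [Submodule.mem_bot]
      tauto
    rw [this, finrank_bot]

theorem HalmosT.scalar {E : Type*} [AddCommGroup E] [Module ℂ E] [FiniteDimensional ℂ E]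
    (p q : E →ₗ[ℂ] E) (a b : ℂ) (ha : a = 0 ∨ a = 1) (hb : b = 0 ∨ b = 1)
    (hp : ∀ x, p x = a • x) (hq : ∀ x, q x = b • x) : HalmosT p q := by
  have hk := finrank_jointK_smul p q a b hp hq
  refine ⟨0, Fin.elim0, fun i => i.elim0, ?_, ?_⟩
  · simp only [hk]
    rcases ha with rfl | rfl <;> rcases hb with rfl | rfl <;> simp
  · intro z₀ z₁ z₂
    have h1 : z₀ • LinearMap.id + z₁ • p + z₂ • q =
        (z₀ + z₁ * a + z₂ * b) • (LinearMap.id : E →ₗ[ℂ] E) := by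
      ext x
      simp [hp, hq, add_smul, mul_smul]
    rw [h1, LinearMap.det_smul, LinearMap.det_id]
    simp only [hk]
    rcases ha with rfl | rfl <;> rcases hb with rfl | rfl <;> simp

theorem HalmosT.generic {E : Type*} [AddCommGroup E] [Module ℂ E]
    (p q : E →ₗ[ℂ] E) (B : Module.Basis (Fin 2) ℂ E) (c : ℝ) (hc : c ∈ Set.Ioo (0 : ℝ) 1)
    (hp0 : p (B 0) = B 0) (hp1 : p (B 1) = (c : ℂ) • B 0)
    (hq0 : q (B 0) = B 1) (hq1 : q (B 1) = B 1)
    (hK : ∀ a b : ℂ, (a = 0 ∨ a = 1) → (b = 0 ∨ b = 1) → jointK p q a b = ⊥) : HalmosT p q := by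
  refine ⟨1, fun _ => 1 - c, fun i => ⟨by linarith [hc.2], by linarith [hc.1]⟩, ?_, ?_⟩
  · rw [hK 0 0 (by simp) (by simp), hK 1 0 (by simp) (by simp), hK 0 1 (by simp) (by simp),
      hK 1 1 (by simp) (by simp), Module.finrank_eq_card_basis B]
    simp
  · intro z₀ z₁ z₂
    rw [hK 0 0 (by simp) (by simp), hK 1 0 (by simp) (by simp), hK 0 1 (by simp) (by simp),
      hK 1 1 (by simp) (by simp), ← LinearMap.det_toMatrix B, Matrix.det_fin_two]
    push_cast
    generalize (c : ℂ) = d at hp1 ⊢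
    simp [LinearMap.toMatrix_apply, hp0, hp1, hq0, hq1]
    ring

theorem HalmosT.of_invariant {E : Type*} [NormedAddCommGroup E] [InnerProductSpace ℂ E]
    [FiniteDimensional ℂ E] (p q : E →ₗ[ℂ] E) (hp : p.IsSymmetric) (hq : q.IsSymmetric)
    (V : Submodule ℂ E) (hpV : ∀ v ∈ V, p v ∈ V) (hqV : ∀ v ∈ V, q v ∈ V)
    (hV : HalmosT (p.restrict hpV) (q.restrict hqV))
    (hW : ∀ (hpW : ∀ v ∈ Vᗮ, p v ∈ Vᗮ) (hqW : ∀ v ∈ Vᗮ, q v ∈ Vᗮ),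
      HalmosT (p.restrict hpW) (q.restrict hqW)) : HalmosT p q := by
  have hpW : ∀ v ∈ Vᗮ, p v ∈ Vᗮ := hp.orthogonalComplement_mem_invtSubmodule hpV
  have hqW : ∀ v ∈ Vᗮ, q v ∈ Vᗮ := hq.orthogonalComplement_mem_invtSubmodule hqV
  refine HalmosT.prod (Submodule.prodEquivOfIsCompl V Vᗮ V.isCompl_orthogonal) p q _ _ _ _
    ?_ ?_ hV (hW hpW hqW)
  · intro x; simp [Submodule.coe_prodEquivOfIsCompl']
  · intro x; simp [Submodule.coe_prodEquivOfIsCompl']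

theorem halmos_vector {E : Type*} [NormedAddCommGroup E] [InnerProductSpace ℂ E]
    [FiniteDimensional ℂ E] [Nontrivial E] (p q : E →ₗ[ℂ] E) (hq : q.IsSymmetric)
    (hp : p.IsSymmetric)
    (hp' : ∀ x, p (p x) = p x) (hq' : ∀ x, q (q x) = q x)
    (hK : ∀ a b : ℂ, (a = 0 ∨ a = 1) → (b = 0 ∨ b = 1) → jointK p q a b = ⊥) :
    ∃ (v : E) (c : ℝ), v ≠ 0 ∧ c ∈ Set.Ioo (0 : ℝ) 1 ∧ p v = v ∧ p (q v) = (c : ℂ) • v := by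
  have hK' : ∀ a b : ℂ, (a = 0 ∨ a = 1) → (b = 0 ∨ b = 1) → ∀ x, p x = a • x → q x = b • x →
      x = 0 := by
    intro a b ha hb x h1 h2
    have : x ∈ jointK p q a b := (mem_jointK _ _ _ _ _).2 ⟨h1, h2⟩
    rwa [hK a b ha hb, Submodule.mem_bot] at this
  have hne : ∃ u, p u ≠ 0 := by
    by_contra! h
    obtain ⟨w, hw⟩ := exists_ne (0 : E)
    have h1 : q w = 0 := hK' 0 1 (by simp) (by simp) (q w) (by simp [h]) (by simp [hq'])
    exact hw (hK' 0 0 (by simp) (by simp) w (by simp [h]) (by simp [h1]))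
  obtain ⟨u, hu⟩ := hne
  have : Nontrivial (LinearMap.range p) :=
    ⟨⟨⟨p u, u, rfl⟩, 0, fun h => hu (by simpa using congrArg Subtype.val h)⟩⟩
  let f : (LinearMap.range p) →ₗ[ℂ] (LinearMap.range p) :=
    (p ∘ₗ q).restrict (fun x _ => ⟨q x, rfl⟩)
  obtain ⟨μ, hμ⟩ := Module.End.exists_eigenvalue f
  obtain ⟨⟨v, w, rfl⟩, hv⟩ := hμ.exists_hasEigenvector
  have hv1 := hv.apply_eq_smul
  have hv2 := hv.2
  replace hv1 : p (q (p w)) = μ • p w := congrArg Subtype.val hv1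
  replace hv2 : p w ≠ 0 := fun h => hv2 (Subtype.ext h)
  have hpv := hp' w
  generalize p w = v at hv1 hv2 hpv
  have hqv : q v ≠ 0 := fun h => hv2 (hK' 1 0 (by simp) (by simp) v (by simpa) (by simpa))
  have hqv' : v - q v ≠ 0 := fun h =>
    hv2 (hK' 1 1 (by simp) (by simp) v (by simpa) (by simpa using (sub_eq_zero.1 h).symm))
  have h1 : inner ℂ v (p (q v)) = inner ℂ (q v) (q v) := by
    rw [← hp, hpv, ← hq' v, ← hq, hq']
  rw [hv1, inner_smul_right] at h1
  have h2 : inner ℂ v v = inner ℂ (q v) (q v) + inner ℂ (v - q v) (v - q v) := by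
    have h3 : inner ℂ v (q v) = inner ℂ (q v) (q v) := by
      rw [← hq' v, ← hq, hq']
    have h4 : inner ℂ (q v) v = inner ℂ (q v) (q v) := by
      rw [← hq' v, hq, hq']
    simp only [inner_sub_left, inner_sub_right, h3, h4]
    ring
  simp only [inner_self_eq_norm_sq_to_K] at h1 h2
  have h2' : ‖v‖ ^ 2 = ‖q v‖ ^ 2 + ‖v - q v‖ ^ 2 := by exact_mod_cast h2
  have n1 : 0 < ‖v‖ ^ 2 := by positivity
  have n2 : 0 < ‖q v‖ ^ 2 := by positivity
  have n3 : 0 < ‖v - q v‖ ^ 2 := by positivity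
  refine ⟨v, ‖q v‖ ^ 2 / ‖v‖ ^ 2, hv2, ⟨by positivity, ?_⟩, hpv, ?_⟩
  · rw [div_lt_one n1]; linarith
  · rw [hv1]
    congr 1
    have : (‖v‖ : ℂ) ≠ 0 := by simpa using hv2
    push_cast
    field_simp
    exact h1

theorem halmos_main (n : ℕ) : ∀ {E : Type} [NormedAddCommGroup E] [InnerProductSpace ℂ E]
    [FiniteDimensional ℂ E] (p q : E →ₗ[ℂ] E), Module.finrank ℂ E = n → p.IsSymmetric →
    q.IsSymmetric → (∀ x, p (p x) = p x) → (∀ x, q (q x) = q x) → HalmosT p q := by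
  induction n using Nat.strong_induction_on with
  | _ n ih =>
  intro E _ _ _ p q hn hp hq hp' hq'
  have step : ∀ (V : Submodule ℂ E) (hpV : ∀ v ∈ V, p v ∈ V) (hqV : ∀ v ∈ V, q v ∈ V), V ≠ ⊥ →
      HalmosT (p.restrict hpV) (q.restrict hqV) → HalmosT p q := by
    intro V hpV hqV hne hV
    refine HalmosT.of_invariant p q hp hq V hpV hqV hV fun hpW hqW => ?_
    refine ih (Module.finrank ℂ Vᗮ) ?_ _ _ rfl (hp.restrict_invariant hpW)
      (hq.restrict_invariant hqW) (fun x => Subtype.ext (hp' x)) (fun x => Subtype.ext (hq' x))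
    have h1 := V.finrank_add_finrank_orthogonal
    have h2 : Module.finrank ℂ V ≠ 0 := by rwa [Ne, Submodule.finrank_eq_zero]
    omega
  by_cases hK : ∀ a b : ℂ, (a = 0 ∨ a = 1) → (b = 0 ∨ b = 1) → jointK p q a b = ⊥
  swap
  · push Not at hK
    obtain ⟨a, b, ha, hb, hab⟩ := hK
    have h1 : ∀ v ∈ jointK p q a b, p v = a • v := fun v hv => ((mem_jointK _ _ _ _ _).1 hv).1
    have h2 : ∀ v ∈ jointK p q a b, q v = b • v := fun v hv => ((mem_jointK _ _ _ _ _).1 hv).2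
    refine step (jointK p q a b) (fun v hv => ?_) (fun v hv => ?_) hab ?_
    · rw [h1 v hv]; exact Submodule.smul_mem _ _ hv
    · rw [h2 v hv]; exact Submodule.smul_mem _ _ hv
    · exact HalmosT.scalar _ _ a b ha hb (fun x => Subtype.ext (h1 x x.2))
        (fun x => Subtype.ext (h2 x x.2))
  rcases subsingleton_or_nontrivial E with hE | hE
  · exact HalmosT.scalar p q 0 0 (by simp) (by simp) (fun x => Subsingleton.elim _ _)
      (fun x => Subsingleton.elim _ _)
  obtain ⟨v, c, hv, hc, hpv, hpqv⟩ := halmos_vector p q hq hp hp' hq' hK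
  have hc0 : (c : ℂ) ≠ 0 := by exact_mod_cast hc.1.ne'
  have hli : LinearIndependent ℂ ![v, q v] := by
    rw [LinearIndependent.pair_iff' hv]
    intro a ha
    have h1 : p (q v) = q v := by rw [← ha, map_smul, hpv]
    have h2 : q v = (c : ℂ) • v := by rw [← h1, hpqv]
    have h3 : q v = v := by
      have := hq' v
      rw [h2, map_smul, h2, ← h2] at this
      have h4 : (c : ℂ) • (q v - v) = 0 := by rw [smul_sub, this, ← h2]; simp
      rw [smul_eq_zero, or_iff_right hc0, sub_eq_zero] at h4
      exact h4
    have : v ∈ jointK p q 1 1 := (mem_jointK _ _ _ _ _).2 ⟨by simpa, by simpa⟩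
    rw [hK 1 1 (by simp) (by simp)] at this
    exact hv this
  have hv0 : v ∈ Submodule.span ℂ (Set.range ![v, q v]) := Submodule.subset_span ⟨0, rfl⟩
  have hv1 : q v ∈ Submodule.span ℂ (Set.range ![v, q v]) := Submodule.subset_span ⟨1, rfl⟩
  have hpV : ∀ x ∈ Submodule.span ℂ (Set.range ![v, q v]),
      p x ∈ Submodule.span ℂ (Set.range ![v, q v]) := by
    change Submodule.span ℂ (Set.range ![v, q v]) ≤
      (Submodule.span ℂ (Set.range ![v, q v])).comap p
    rw [Submodule.span_le]
    rintro _ ⟨i, rfl⟩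
    fin_cases i
    · simpa [hpv] using hv0
    · simpa [hpqv] using Submodule.smul_mem _ (c : ℂ) hv0
  have hqV : ∀ x ∈ Submodule.span ℂ (Set.range ![v, q v]),
      q x ∈ Submodule.span ℂ (Set.range ![v, q v]) := by
    change Submodule.span ℂ (Set.range ![v, q v]) ≤
      (Submodule.span ℂ (Set.range ![v, q v])).comap q
    rw [Submodule.span_le]
    rintro _ ⟨i, rfl⟩
    fin_cases i
    · simpa using hv1
    · simpa [hq'] using hv1
  refine step _ hpV hqV (fun h => hv (by rwa [h] at hv0)) ?_
  refine HalmosT.generic _ _ (Module.Basis.span hli) c hc ?_ ?_ ?_ ?_ ?_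
  · apply Subtype.ext; simp [Module.Basis.span_apply, hpv]
  · apply Subtype.ext; simp [Module.Basis.span_apply, hpqv]
  · apply Subtype.ext; simp [Module.Basis.span_apply]
  · apply Subtype.ext; simp [Module.Basis.span_apply, hq']
  · intro a b ha hb
    rw [eq_bot_iff]
    intro x hx
    rw [mem_jointK] at hx
    have : (x : E) ∈ jointK p q a b :=
      (mem_jointK _ _ _ _ _).2 ⟨congrArg Subtype.val hx.1, congrArg Subtype.val hx.2⟩
    rw [hK a b ha hb, Submodule.mem_bot] at this
    exact Subtype.ext this

theorem mem_range_idem {E : Type*} [AddCommGroup E] [Module ℂ E] (p : E →ₗ[ℂ] E)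
    (hp' : ∀ x, p (p x) = p x) (x : E) : x ∈ LinearMap.range p ↔ p x = (1 : ℂ) • x := by
  rw [one_smul]
  constructor
  · rintro ⟨y, rfl⟩; exact hp' y
  · intro h; exact ⟨x, h⟩

theorem mem_range_orth {E : Type*} [NormedAddCommGroup E] [InnerProductSpace ℂ E]
    (p : E →ₗ[ℂ] E) (hp : p.IsSymmetric) (x : E) :
    x ∈ (LinearMap.range p)ᗮ ↔ p x = (0 : ℂ) • x := by
  rw [zero_smul, hp.orthogonal_range, LinearMap.mem_ker]

/-- Explicit factorization of the characteristic polynomial of two projections,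
following the Halmos decomposition:
det(z₀I + z₁P + z₂Q) = z₀^{k₁}(z₀+z₁)^{k₂}(z₀+z₂)^{k₃}(z₀+z₁+z₂)^{k₄}
  ∏ᵢ (z₀² + z₀(z₁+z₂) + xᵢ z₁z₂) with xᵢ ∈ (0,1) and k₁+k₂+k₃+k₄+2m = k. -/
theorem stmt_11 {k : ℕ} (P Q : Matrix (Fin k) (Fin k) ℂ)
    (hP : P.IsHermitian) (hP' : P * P = P)
    (hQ : Q.IsHermitian) (hQ' : Q * Q = Q)
    (L N : Submodule ℂ (EuclideanSpace ℂ (Fin k)))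
    (hL : L = LinearMap.range (Matrix.toEuclideanLin P))
    (hN : N = LinearMap.range (Matrix.toEuclideanLin Q))
    (k₁ k₂ k₃ k₄ : ℕ)
    (hk₁ : k₁ = Module.finrank ℂ ↥(Lᗮ ⊓ Nᗮ))
    (hk₂ : k₂ = Module.finrank ℂ ↥(L ⊓ Nᗮ))
    (hk₃ : k₃ = Module.finrank ℂ ↥(Lᗮ ⊓ N))
    (hk₄ : k₄ = Module.finrank ℂ ↥(L ⊓ N)) :
    ∃ (m : ℕ) (x : Fin m → ℝ),
      (∀ i, x i ∈ Set.Ioo (0 : ℝ) 1) ∧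
      k₁ + k₂ + k₃ + k₄ + 2 * m = k ∧
      ∀ z₀ z₁ z₂ : ℂ,
        (z₀ • (1 : Matrix (Fin k) (Fin k) ℂ) + z₁ • P + z₂ • Q).det =
          z₀ ^ k₁ * (z₀ + z₁) ^ k₂ * (z₀ + z₂) ^ k₃ * (z₀ + z₁ + z₂) ^ k₄ *
            ∏ i, (z₀ ^ 2 + z₀ * (z₁ + z₂) + (x i : ℂ) * z₁ * z₂) := by
  have hp : (Matrix.toEuclideanLin P).IsSymmetric := Matrix.isSymmetric_toEuclideanLin_iff.2 hP
  have hq : (Matrix.toEuclideanLin Q).IsSymmetric := Matrix.isSymmetric_toEuclideanLin_iff.2 hQ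
  have hp' : ∀ x, Matrix.toEuclideanLin P (Matrix.toEuclideanLin P x) =
      Matrix.toEuclideanLin P x := by
    intro x; simp [Matrix.toEuclideanLin_apply, Matrix.mulVec_mulVec, hP']
  have hq' : ∀ x, Matrix.toEuclideanLin Q (Matrix.toEuclideanLin Q x) =
      Matrix.toEuclideanLin Q x := by
    intro x; simp [Matrix.toEuclideanLin_apply, Matrix.mulVec_mulVec, hQ']
  obtain ⟨m, x, hx, hm, hd⟩ := halmos_main _ (Matrix.toEuclideanLin P) (Matrix.toEuclideanLin Q)
    rfl hp hq hp' hq'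
  have e1 : Lᗮ ⊓ Nᗮ = jointK (Matrix.toEuclideanLin P) (Matrix.toEuclideanLin Q) 0 0 := by
    ext x
    rw [mem_jointK, Submodule.mem_inf, hL, hN, mem_range_orth _ hp, mem_range_orth _ hq]
  have e2 : L ⊓ Nᗮ = jointK (Matrix.toEuclideanLin P) (Matrix.toEuclideanLin Q) 1 0 := by
    ext x
    rw [mem_jointK, Submodule.mem_inf, hL, hN, mem_range_idem _ hp', mem_range_orth _ hq]
  have e3 : Lᗮ ⊓ N = jointK (Matrix.toEuclideanLin P) (Matrix.toEuclideanLin Q) 0 1 := by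
    ext x
    rw [mem_jointK, Submodule.mem_inf, hL, hN, mem_range_orth _ hp, mem_range_idem _ hq']
  have e4 : L ⊓ N = jointK (Matrix.toEuclideanLin P) (Matrix.toEuclideanLin Q) 1 1 := by
    ext x
    rw [mem_jointK, Submodule.mem_inf, hL, hN, mem_range_idem _ hp', mem_range_idem _ hq']
  rw [e1] at hk₁
  rw [e2] at hk₂
  rw [e3] at hk₃
  rw [e4] at hk₄
  rw [← hk₁, ← hk₂, ← hk₃, ← hk₄, finrank_euclideanSpace_fin] at hm
  rw [← hk₁, ← hk₂, ← hk₃, ← hk₄] at hd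
  refine ⟨m, x, hx, hm, fun z₀ z₁ z₂ => ?_⟩
  rw [← hd, ← LinearMap.det_toLin (EuclideanSpace.basisFun (Fin k) ℂ).toBasis]
  congr 1
  simp [Matrix.toEuclideanLin_eq_toLin_orthonormal]
end
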